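/- Let T > 0. Let a : ℝ → ℝ be a locally integrable T-periodic function satisfying (a#) and (a*). Let g : [0,+∞) → [0,+∞) be continuous, regularly oscillating at zero, satisfy (g*), and satisfy lim_{s→0⁺} g(s)/s = 0. Then there exists λ* > 0 such that for every λ > λ*, the Minkowski curvature equation (u'/√(1-(u')²))' + λ a(t) g(u) = 0 has at least one T-periodic solution u with u(t) > 0 for all t ∈ ℝ. -/

import Mathlib

open MeasureTheory Set Filter

noncomputable section

/-- `(u, v)` is a `T`-periodic solution of the planar system `u' = F t (v t)`,
`v' = G t (u t)`: both components are continuous, `T`-periodic, and are primitives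
(in the sense of the integral form, equivalent to absolute continuity plus the
differential equations holding almost everywhere) of the right-hand sides. -/
def IsPeriodicSol (T : ℝ) (F G : ℝ → ℝ → ℝ) (u v : ℝ → ℝ) : Prop :=
  Continuous u ∧ Continuous v ∧
  Function.Periodic u T ∧ Function.Periodic v T ∧
  (∀ t₁ t₂ : ℝ, IntervalIntegrable (fun s => F s (v s)) volume t₁ t₂) ∧
  (∀ t₁ t₂ : ℝ, IntervalIntegrable (fun s => G s (u s)) volume t₁ t₂) ∧
  (∀ t : ℝ, u t = u 0 + ∫ s in (0:ℝ)..t, F s (v s)) ∧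
  (∀ t : ℝ, v t = v 0 + ∫ s in (0:ℝ)..t, G s (u s))

/-- Condition (a*): there are `N + 1 ≥ 1` pairwise disjoint closed intervals
`[σ n, τ n]` contained in a period, on which `a > 0` a.e., while `a ≤ 0` a.e.
on the rest of the period. -/
def SignChanging (T : ℝ) (a : ℝ → ℝ) (N : ℕ) (σ τ : Fin (N + 1) → ℝ) : Prop :=
  (∀ n, σ n < τ n) ∧
  (∀ m n : Fin (N + 1), m < n → τ m < σ n) ∧
  (∀ n, τ n < σ 0 + T) ∧
  (∀ n, ∀ᵐ t ∂volume, t ∈ Set.Icc (σ n) (τ n) → 0 < a t) ∧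
  (∀ᵐ t ∂volume, t ∈ Set.Ico (σ 0) (σ 0 + T) \ (⋃ n, Set.Icc (σ n) (τ n)) → a t ≤ 0)

/-- `g` is regularly oscillating at zero: `g (ω s) / g s → 1` as `s → 0⁺` and `ω → 1`. -/
def RegOscZero (g : ℝ → ℝ) : Prop :=
  Tendsto (fun p : ℝ × ℝ => g (p.1 * p.2) / g p.2)
    ((nhds 1) ×ˢ (nhdsWithin 0 (Set.Ioi 0))) (nhds 1)

/-- The velocity corresponding to a relativistic momentum. -/
def relVel (s : ℝ) : ℝ := s / Real.sqrt (1 + s ^ 2)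

theorem sqrt_one_add_sq_pos (s : ℝ) : 0 < Real.sqrt (1 + s ^ 2) :=
  Real.sqrt_pos.2 (by positivity)

theorem continuous_relVel : Continuous relVel := by
  unfold relVel
  exact continuous_id.div (by fun_prop) fun s => (sqrt_one_add_sq_pos s).ne'

theorem relVel_neg (s : ℝ) : relVel (-s) = -relVel s := by
  simp [relVel, neg_div]

theorem relVel_zero : relVel 0 = 0 := by simp [relVel]

theorem strictMono_relVel : StrictMono relVel := by
  have hpos : ∀ x y : ℝ, 0 ≤ x → x < y → relVel x < relVel y := by
    intro x y hx hxy
    have hx2 : relVel x = Real.sqrt (x ^ 2 / (1 + x ^ 2)) := by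
      rw [Real.sqrt_div (by positivity), Real.sqrt_sq hx, relVel]
    have hy2 : relVel y = Real.sqrt (y ^ 2 / (1 + y ^ 2)) := by
      rw [Real.sqrt_div (by positivity), Real.sqrt_sq (by linarith), relVel]
    rw [hx2, hy2]
    apply Real.sqrt_lt_sqrt (by positivity)
    rw [div_lt_div_iff₀ (by positivity) (by positivity)]
    nlinarith
  intro x y hxy
  rcases le_total 0 x with hx | hx
  · exact hpos x y hx hxy
  · rcases le_total y 0 with hy | hy
    · have := hpos (-y) (-x) (by linarith) (by linarith)
      rw [relVel_neg, relVel_neg] at this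
      linarith
    · have h1 : relVel x ≤ 0 := div_nonpos_of_nonpos_of_nonneg hx (sqrt_one_add_sq_pos x).le
      have h2 : 0 ≤ relVel y := div_nonneg hy (sqrt_one_add_sq_pos y).le
      rcases hx.lt_or_eq with hx' | rfl
      · exact lt_of_lt_of_le (div_neg_of_neg_of_pos hx' (sqrt_one_add_sq_pos x)) h2
      · exact lt_of_le_of_lt h1 (div_pos hxy (sqrt_one_add_sq_pos y))

theorem relVel_pos {s : ℝ} (hs : 0 < s) : 0 < relVel s := by
  simpa [relVel_zero] using strictMono_relVel hs

theorem relVel_nonpos {s : ℝ} (hs : s ≤ 0) : relVel s ≤ 0 := by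
  simpa [relVel_zero] using strictMono_relVel.monotone hs

theorem abs_relVel (s : ℝ) : |relVel s| = |s| / Real.sqrt (1 + s ^ 2) := by
  rw [relVel, abs_div, abs_of_pos (sqrt_one_add_sq_pos s)]

theorem abs_relVel_le_one (s : ℝ) : |relVel s| ≤ 1 := by
  rw [abs_relVel, div_le_one (sqrt_one_add_sq_pos s), ← Real.sqrt_sq_eq_abs]
  exact Real.sqrt_le_sqrt (by linarith)

theorem abs_relVel_le_abs (s : ℝ) : |relVel s| ≤ |s| := by
  rw [abs_relVel]
  exact div_le_self (abs_nonneg s) (Real.one_le_sqrt.2 (by nlinarith))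

theorem half_lt_relVel_one : 1 / 2 < relVel 1 := by
  rw [relVel, lt_div_iff₀ (sqrt_one_add_sq_pos 1)]
  have h : Real.sqrt (1 + 1 ^ 2) < 2 := by
    rw [Real.sqrt_lt' (by norm_num)]; norm_num
  calc 1 / 2 * Real.sqrt (1 + 1 ^ 2) < 1 / 2 * 2 := mul_lt_mul_of_pos_left h (by norm_num)
    _ = 1 := by norm_num

theorem intervalIntegrable_mul_of_continuous {b φ : ℝ → ℝ}
    (hb : ∀ p q, IntervalIntegrable b volume p q) (hφ : Continuous φ) (p q : ℝ) :
    IntervalIntegrable (fun x => b x * φ x) volume p q :=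
  (hb p q).mul_continuousOn hφ.continuousOn

theorem abs_integral_relVel_le {v : ℝ → ℝ} (s t : ℝ) :
    |∫ x in s..t, relVel (v x)| ≤ |t - s| := by
  have := intervalIntegral.norm_integral_le_of_norm_le_const (a := s) (b := t) (C := 1)
    (f := fun x => relVel (v x)) fun x _ => abs_relVel_le_one (v x)
  simpa using this

theorem continuous_parametric_weighted_primitive {X : Type*} [TopologicalSpace X]
    [FirstCountableTopology X] {b h : ℝ → ℝ} {B : ℝ}
    (hb : ∀ p q, IntervalIntegrable b volume p q) (hh : Continuous h) (hB : ∀ s, |h s| ≤ B)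
    {f : X → ℝ → ℝ} (hf : Continuous f.uncurry) :
    Continuous fun p : X × ℝ => ∫ r in (0 : ℝ)..p.2, b r * h (f p.1 r) := by
  rw [continuous_iff_continuousAt]
  rintro ⟨x₀, b₀⟩
  have hfx : ∀ x, Continuous (f x) := fun x => hf.comp (by fun_prop : Continuous fun r => (x, r))
  have hft : ∀ t, Continuous fun x => f x t := fun t =>
    hf.comp (by fun_prop : Continuous fun x => (x, t))
  refine intervalIntegral.continuousAt_parametric_primitive_of_dominated
    (F := fun x r => b r * h (f x r)) (fun r => |b r| * B)
    (min 0 b₀ - 1) (max 0 b₀ + 1) ?_ ?_ ?_ ?_ ?_ ?_ (by simp)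
  · intro x
    exact (intervalIntegrable_iff.1
      (intervalIntegrable_mul_of_continuous hb (hh.comp (hfx x)) _ _)).aestronglyMeasurable
  · refine Eventually.of_forall fun x => Eventually.of_forall fun r => ?_
    rw [norm_mul]
    exact mul_le_mul_of_nonneg_left (hB _) (norm_nonneg _)
  · exact (hb _ _).abs.mul_const B
  · exact Eventually.of_forall fun r =>
      (continuous_const.mul (hh.comp (hft r))).continuousAt
  · constructor <;> [have := min_le_left 0 b₀; have := le_max_left 0 b₀] <;> linarith
  · constructor <;> [have := min_le_right 0 b₀; have := le_max_right 0 b₀] <;> linarith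

/-- Successive approximations of the planar system in integral form, with delay `d` in the
second equation. -/
def delayIter (b h : ℝ → ℝ) (d : ℝ) : ℕ → ℝ × ℝ → ℝ → ℝ
  | 0, z, _ => z.1
  | k + 1, z, t => z.1 + ∫ s in (0 : ℝ)..t,
      relVel (z.2 - ∫ r in (0 : ℝ)..s, b r * h (delayIter b h d k z (max (r - d) 0)))

theorem continuous_delayIter {b h : ℝ → ℝ} {B : ℝ}
    (hb : ∀ p q, IntervalIntegrable b volume p q) (hh : Continuous h) (hB : ∀ s, |h s| ≤ B)
    (d : ℝ) (k : ℕ) : Continuous (delayIter b h d k).uncurry := by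
  induction k with
  | zero => exact continuous_fst.comp continuous_fst
  | succ k ih =>
    have h1 : Continuous (fun (z : ℝ × ℝ) (r : ℝ) =>
        delayIter b h d k z (max (r - d) 0)).uncurry :=
      ih.comp (by fun_prop : Continuous fun p : (ℝ × ℝ) × ℝ => (p.1, max (p.2 - d) 0))
    have h2 := continuous_parametric_weighted_primitive hb hh hB h1
    have h3 : Continuous (fun (z : ℝ × ℝ) (s : ℝ) => relVel (z.2 -
        ∫ r in (0 : ℝ)..s, b r * h (delayIter b h d k z (max (r - d) 0)))).uncurry :=
      continuous_relVel.comp ((continuous_snd.comp continuous_fst).sub h2)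
    exact (continuous_fst.comp continuous_fst).add
      (intervalIntegral.continuous_parametric_primitive_of_continuous h3)

theorem delayIter_zero_time (b h : ℝ → ℝ) (d : ℝ) (k : ℕ) (z : ℝ × ℝ) :
    delayIter b h d k z 0 = z.1 := by
  cases k <;> simp [delayIter]

theorem delayIter_succ_eq {b h : ℝ → ℝ} {d : ℝ} (hd : 0 ≤ d) (z : ℝ × ℝ) (k : ℕ) :
    ∀ t ∈ Icc 0 (k * d), delayIter b h d (k + 1) z t = delayIter b h d k z t := by
  induction k with
  | zero =>
    intro t ht
    have : t = 0 := by simpa using ht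
    rw [this, delayIter_zero_time, delayIter_zero_time]
  | succ k ih =>
    intro t ht
    have ht2 : t ≤ k * d + d := by have := ht.2; push_cast at this; linarith
    rw [delayIter, delayIter]
    congr 1
    apply intervalIntegral.integral_congr
    intro s hs
    rw [uIcc_of_le ht.1] at hs
    simp only
    congr 2
    apply intervalIntegral.integral_congr
    intro r hr
    rw [uIcc_of_le hs.1] at hr
    simp only
    rw [ih _ ⟨le_max_right _ _, max_le (by linarith [hr.2, hs.2]) (by positivity)⟩]

theorem lipschitzWith_delayIter {b h : ℝ → ℝ} {B : ℝ}
    (hb : ∀ p q, IntervalIntegrable b volume p q) (hh : Continuous h) (hB : ∀ s, |h s| ≤ B)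
    (d : ℝ) (k : ℕ) (z : ℝ × ℝ) : LipschitzWith 1 (delayIter b h d k z) := by
  cases k with
  | zero => exact (LipschitzWith.const z.1).weaken zero_le_one
  | succ k =>
    have h1 : Continuous (fun (z : ℝ × ℝ) (r : ℝ) =>
        delayIter b h d k z (max (r - d) 0)).uncurry :=
      (continuous_delayIter hb hh hB d k).comp
        (by fun_prop : Continuous fun p : (ℝ × ℝ) × ℝ => (p.1, max (p.2 - d) 0))
    have h2 := continuous_parametric_weighted_primitive hb hh hB h1
    have h3 : Continuous fun s : ℝ => relVel (z.2 -
        ∫ r in (0 : ℝ)..s, b r * h (delayIter b h d k z (max (r - d) 0))) :=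
      continuous_relVel.comp (continuous_const.sub
        (h2.comp (by fun_prop : Continuous fun s : ℝ => (z, s))))
    refine LipschitzWith.of_dist_le_mul fun t s => ?_
    rw [Real.dist_eq, Real.dist_eq, delayIter, delayIter, add_sub_add_left_eq_sub,
      intervalIntegral.integral_interval_sub_left (h3.intervalIntegrable _ _)
        (h3.intervalIntegrable _ _)]
    simpa using abs_integral_relVel_le s t

/-- Integral form of the planar system `u' = relVel v`, `v' = -b h(u)` on `[p, q]`. -/
structure PlanarSol (b h : ℝ → ℝ) (p q : ℝ) (u v : ℝ → ℝ) : Prop where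
  cu : Continuous u
  cv : Continuous v
  eu : ∀ s ∈ Icc p q, ∀ t ∈ Icc p q, u t - u s = ∫ x in s..t, relVel (v x)
  ev : ∀ s ∈ Icc p q, ∀ t ∈ Icc p q, v t - v s = -∫ x in s..t, b x * h (u x)

theorem PlanarSol.of_initial {b h u v : ℝ → ℝ} {T : ℝ}
    (hb : ∀ p q, IntervalIntegrable b volume p q) (hh : Continuous h)
    (cu : Continuous u) (cv : Continuous v)
    (eu : ∀ t ∈ Icc 0 T, u t = u 0 + ∫ x in (0 : ℝ)..t, relVel (v x))
    (ev : ∀ t ∈ Icc 0 T, v t = v 0 - ∫ x in (0 : ℝ)..t, b x * h (u x)) :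
    PlanarSol b h 0 T u v := by
  refine ⟨cu, cv, fun s hs t ht => ?_, fun s hs t ht => ?_⟩
  · rw [eu t ht, eu s hs, add_sub_add_left_eq_sub, intervalIntegral.integral_interval_sub_left]
    all_goals exact (continuous_relVel.comp cv).intervalIntegrable _ _
  · rw [ev t ht, ev s hs, sub_sub_sub_cancel_left, ← neg_sub,
      intervalIntegral.integral_interval_sub_left]
    all_goals exact intervalIntegrable_mul_of_continuous hb (hh.comp cu) _ _

open Topology in
/-- Solvability of the planar system with the initial point and the increments over `[0, T]`
in a closed set, from the same property for arbitrary continuous increment maps. -/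
theorem exists_planarSol_of_forall_continuous {b h : ℝ → ℝ} {B T : ℝ} (hT : 0 < T)
    (hb : ∀ p q, IntervalIntegrable b volume p q) (hh : Continuous h) (hB : ∀ s, |h s| ≤ B)
    {Q : Set (ℝ × ℝ)} (hQ : IsCompact Q) {S : Set ((ℝ × ℝ) × ℝ × ℝ)} (hS : IsClosed S)
    {Ψ : ℝ × ℝ → ℝ × ℝ} (hΨ : Continuous Ψ)
    (H : ∀ F₁ F₂ : ℝ × ℝ → ℝ, Continuous F₁ → Continuous F₂ → ∃ x ∈ Q, (x, F₁ x, F₂ x) ∈ S) :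
    ∃ x ∈ Q, ∃ u v : ℝ → ℝ, PlanarSol b h 0 T u v ∧ u 0 = (Ψ x).1 ∧ v 0 = (Ψ x).2 ∧
      (x, u T - u 0, v T - v 0) ∈ S := by
  have approx : ∀ n : ℕ, ∃ x ∈ Q, ∃ w : ℝ → ℝ, w 0 = (Ψ x).1 ∧ LipschitzWith 1 w ∧
      (∀ t ∈ Icc 0 T, w t = (Ψ x).1 + ∫ s in (0 : ℝ)..t, relVel ((Ψ x).2 -
        ∫ r in (0 : ℝ)..s, b r * h (w (max (r - 1 / ((n : ℝ) + 1)) 0)))) ∧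
      (x, w T - (Ψ x).1, -∫ r in (0 : ℝ)..T, b r * h (w (max (r - 1 / ((n : ℝ) + 1)) 0))) ∈ S := by
    intro n
    have hd : (0 : ℝ) < 1 / ((n : ℝ) + 1) := Nat.one_div_pos_of_nat
    set d : ℝ := 1 / ((n : ℝ) + 1)
    obtain ⟨m, hm⟩ := exists_nat_ge (T / d)
    have hm : T ≤ m * d := (div_le_iff₀ hd).1 hm
    have hc := continuous_delayIter hb hh hB d m
    have h1 : Continuous (fun (z : ℝ × ℝ) (r : ℝ) =>
        delayIter b h d m z (max (r - d) 0)).uncurry :=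
      hc.comp (by fun_prop : Continuous fun p : (ℝ × ℝ) × ℝ => (p.1, max (p.2 - d) 0))
    have h2 := continuous_parametric_weighted_primitive hb hh hB h1
    obtain ⟨x, hx, hxS⟩ := H (fun x => delayIter b h d m (Ψ x) T - (Ψ x).1)
      (fun x => -∫ r in (0 : ℝ)..T, b r * h (delayIter b h d m (Ψ x) (max (r - d) 0)))
      ((hc.comp (by fun_prop : Continuous fun x => (Ψ x, T))).sub (by fun_prop))
      (h2.comp (by fun_prop : Continuous fun x => (Ψ x, T))).neg
    refine ⟨x, hx, delayIter b h d m (Ψ x), delayIter_zero_time _ _ _ _ _,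
      lipschitzWith_delayIter hb hh hB d m _, fun t ht => ?_, hxS⟩
    rw [← delayIter_succ_eq hd.le (Ψ x) m t ⟨ht.1, ht.2.trans hm⟩]
    rfl
  choose x hxQ w hw0 hwl hw hxS using approx
  obtain ⟨R, hR⟩ := (hQ.image (continuous_fst.comp hΨ)).isBounded.exists_norm_le
  have hRx : ∀ n, |w n 0| ≤ R := fun n => by
    rw [hw0]; exact hR _ ⟨x n, hxQ n, rfl⟩
  let A : Set (BoundedContinuousFunction (Icc 0 T) ℝ) :=
    {f | ∀ s t, dist (f s) (f t) ≤ dist s t} ∩ {f | ∀ t, f t ∈ Icc (-(R + T)) (R + T)}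
  have hA : IsCompact A := by
    refine BoundedContinuousFunction.arzela_ascoli₂ (Icc (-(R + T)) (R + T)) isCompact_Icc A ?_
      (fun f t hf => hf.2 t) ?_
    · refine IsClosed.inter ?_ ?_
      · simp only [ofPred_forall]
        exact isClosed_iInter fun s => isClosed_iInter fun t =>
          isClosed_le (by fun_prop) continuous_const
      · simp only [ofPred_forall]
        exact isClosed_iInter fun t => isClosed_Icc.preimage (by fun_prop)
    · refine LipschitzWith.uniformEquicontinuous _ 1 (fun f => ?_) |>.equicontinuous
      exact LipschitzWith.of_dist_le_mul fun s t => by simpa using f.2.1 s t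
  let W : ℕ → BoundedContinuousFunction (Icc 0 T) ℝ := fun n =>
    BoundedContinuousFunction.mkOfCompact ⟨fun t => w n t,
      (hwl n).continuous.comp continuous_subtype_val⟩
  have hW : ∀ n, W n ∈ A := by
    intro n
    constructor
    · intro s t
      have := (hwl n).dist_le_mul s t
      rw [NNReal.coe_one, one_mul] at this
      exact this
    · intro t
      have h1 := (hwl n).dist_le_mul t 0
      rw [Real.dist_eq, Real.dist_eq, sub_zero, abs_of_nonneg t.2.1, NNReal.coe_one, one_mul] at h1
      have h2 := abs_le.1 (hRx n)
      have h3 := abs_le.1 h1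
      have h4 := t.2.2
      change w n t ∈ _
      constructor <;> linarith
  obtain ⟨⟨x', W'⟩, hmem, φ, hφ, hlim⟩ := (hQ.prod hA).tendsto_subseq
    (x := fun n => (x n, W n)) fun n => ⟨hxQ n, hW n⟩
  have hxl : Tendsto (fun n => x (φ n)) atTop (𝓝 x') := (continuous_fst.tendsto _).comp hlim
  have hWl : Tendsto (fun n => W (φ n)) atTop (𝓝 W') := (continuous_snd.tendsto _).comp hlim
  let u : ℝ → ℝ := fun t => W' (projIcc 0 T hT.le t)
  have cu : Continuous u := W'.continuous.comp continuous_projIcc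
  have hu : ∀ t ∈ Icc 0 T, Tendsto (fun n => w (φ n) t) atTop (𝓝 (u t)) := by
    intro t ht
    have h1 : Tendsto (fun n => W (φ n) ⟨t, ht⟩) atTop (𝓝 (W' ⟨t, ht⟩)) :=
      ((by fun_prop : Continuous fun f : BoundedContinuousFunction (Icc 0 T) ℝ =>
        f ⟨t, ht⟩).tendsto W').comp hWl
    simp only [u, projIcc_of_mem hT.le ht]
    exact h1
  have hdl : Tendsto (fun n => 1 / (((φ n : ℕ) : ℝ) + 1)) atTop (𝓝 0) :=
    tendsto_one_div_add_atTop_nhds_zero_nat.comp hφ.tendsto_atTop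
  have hud : ∀ t ∈ Icc 0 T,
      Tendsto (fun n => w (φ n) (max (t - 1 / (((φ n : ℕ) : ℝ) + 1)) 0)) atTop (𝓝 (u t)) := by
    intro t ht
    refine tendsto_of_tendsto_of_dist (hu t ht) (squeeze_zero (fun _ => dist_nonneg) (fun n => ?_) hdl)
    refine ((hwl (φ n)).dist_le_mul _ _).trans ?_
    rw [NNReal.coe_one, one_mul, Real.dist_eq]
    have hp : (0 : ℝ) < 1 / (((φ n : ℕ) : ℝ) + 1) := Nat.one_div_pos_of_nat
    rw [abs_of_nonneg (sub_nonneg.2 (max_le (by linarith) ht.1))]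
    linarith [le_max_left (t - 1 / (((φ n : ℕ) : ℝ) + 1)) 0]
  have hΨl : Tendsto (fun n => Ψ (x (φ n))) atTop (𝓝 (Ψ x')) := (hΨ.tendsto _).comp hxl
  have hΨ1 : Tendsto (fun n => (Ψ (x (φ n))).1) atTop (𝓝 (Ψ x').1) := hΨl.fst_nhds
  have hΨ2 : Tendsto (fun n => (Ψ (x (φ n))).2) atTop (𝓝 (Ψ x').2) := hΨl.snd_nhds
  have hcw : ∀ n : ℕ, Continuous fun r => h (w n (max (r - 1 / ((n : ℝ) + 1)) 0)) := fun n =>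
    hh.comp ((hwl n).continuous.comp (by fun_prop))
  have hlimInt : ∀ t ∈ Icc 0 T, Tendsto (fun n => ∫ r in (0 : ℝ)..t,
      b r * h (w (φ n) (max (r - 1 / (((φ n : ℕ) : ℝ) + 1)) 0))) atTop
      (𝓝 (∫ r in (0 : ℝ)..t, b r * h (u r))) := by
    intro t ht
    refine intervalIntegral.tendsto_integral_filter_of_dominated_convergence
      (fun r => |b r| * B) ?_ ?_ ((hb _ _).abs.mul_const B) ?_
    · exact Eventually.of_forall fun n => (intervalIntegrable_iff.1
        (intervalIntegrable_mul_of_continuous hb (hcw (φ n)) _ _)).aestronglyMeasurable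
    · refine Eventually.of_forall fun n => Eventually.of_forall fun r _ => ?_
      rw [norm_mul]
      exact mul_le_mul_of_nonneg_left (hB _) (norm_nonneg _)
    · refine Eventually.of_forall fun r hr => ?_
      rw [uIoc_of_le ht.1] at hr
      exact tendsto_const_nhds.mul ((hh.tendsto _).comp (hud r ⟨hr.1.le, hr.2.trans ht.2⟩))
  let v : ℝ → ℝ := fun t => (Ψ x').2 - ∫ r in (0 : ℝ)..t, b r * h (u r)
  have cv : Continuous v := continuous_const.sub (intervalIntegral.continuous_primitive
    (intervalIntegrable_mul_of_continuous hb (hh.comp cu)) 0)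
  have hu0 : u 0 = (Ψ x').1 := by
    refine tendsto_nhds_unique (hu 0 ⟨le_rfl, hT.le⟩) ?_
    simpa only [hw0] using hΨ1
  have hv0 : v 0 = (Ψ x').2 := by simp [v]
  have heu : ∀ t ∈ Icc 0 T, u t = u 0 + ∫ x in (0 : ℝ)..t, relVel (v x) := by
    intro t ht
    refine tendsto_nhds_unique (hu t ht) ?_
    simp_rw [fun n => hw (φ n) t ht]
    rw [hu0]
    refine hΨ1.add ?_
    refine intervalIntegral.tendsto_integral_filter_of_dominated_convergence
      (fun _ => 1) ?_ ?_ intervalIntegrable_const ?_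
    · refine Eventually.of_forall fun n => Continuous.aestronglyMeasurable ?_
      exact continuous_relVel.comp (continuous_const.sub (intervalIntegral.continuous_primitive
        (intervalIntegrable_mul_of_continuous hb (hcw (φ n))) 0))
    · exact Eventually.of_forall fun n => Eventually.of_forall fun r _ => abs_relVel_le_one _
    · refine Eventually.of_forall fun s hs => ?_
      rw [uIoc_of_le ht.1] at hs
      exact (continuous_relVel.tendsto _).comp
        (hΨ2.sub (hlimInt s ⟨hs.1.le, hs.2.trans ht.2⟩))
  refine ⟨x', hmem.1, u, v, PlanarSol.of_initial hb hh cu cv heu fun t _ => ?_,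
    hu0, hv0, ?_⟩
  · rw [hv0]
  · have hTm : T ∈ Icc 0 T := ⟨hT.le, le_rfl⟩
    refine hS.mem_of_tendsto (b := atTop) ?_ (Eventually.of_forall fun n => hxS (φ n))
    refine hxl.prodMk_nhds (Tendsto.prodMk_nhds ?_ ?_)
    · rw [hu0]
      exact (hu T hTm).sub hΨ1
    · have : v T - v 0 = -∫ r in (0 : ℝ)..T, b r * h (u r) := by rw [hv0]; simp [v]
      rw [this]
      exact (hlimInt T hTm).neg

/-- A continuous nowhere vanishing planar map on the plane has a continuous argument. -/
theorem exists_continuous_arg {F₁ F₂ : ℝ × ℝ → ℝ} (h₁ : Continuous F₁) (h₂ : Continuous F₂)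
    (h : ∀ x, F₁ x ≠ 0 ∨ F₂ x ≠ 0) :
    ∃ R θ : ℝ × ℝ → ℝ, Continuous θ ∧ ∀ x, 0 < R x ∧
      F₁ x = R x * Real.cos (θ x) ∧ F₂ x = R x * Real.sin (θ x) := by
  have hne : ∀ x, (⟨F₁ x, F₂ x⟩ : ℂ) ≠ 0 := by
    intro x hx
    rcases h x with h' | h'
    · exact h' (congrArg Complex.re hx)
    · exact h' (congrArg Complex.im hx)
  have hc : Continuous fun x => (⟨F₁ x, F₂ x⟩ : ℂ) := by
    have : (fun x => (⟨F₁ x, F₂ x⟩ : ℂ)) = fun x => (F₁ x : ℂ) + (F₂ x : ℂ) * Complex.I := by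
      funext x; exact Complex.mk_eq_add_mul_I _ _
    rw [this]
    fun_prop
  let f : C(ℝ × ℝ, {z : ℂ // z ≠ 0}) := ⟨fun x => ⟨⟨F₁ x, F₂ x⟩, hne x⟩, hc.subtype_mk _⟩
  obtain ⟨L, ⟨-, hL⟩, -⟩ := Complex.isCoveringMap_exp.existsUnique_continuousMap_lifts f (0, 0)
    (Complex.log ⟨F₁ (0, 0), F₂ (0, 0)⟩) (by
      apply Subtype.ext
      exact Complex.exp_log (hne _))
  have hexp : ∀ x, Complex.exp (L x) = ⟨F₁ x, F₂ x⟩ := fun x =>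
    congrArg Subtype.val (congrFun hL x)
  refine ⟨fun x => Real.exp (L x).re, fun x => (L x).im,
    Complex.continuous_im.comp L.continuous, fun x => ⟨Real.exp_pos _, ?_, ?_⟩⟩
  · rw [← Complex.exp_re, hexp]
  · rw [← Complex.exp_im, hexp]

theorem lt_of_forall_ne {f : ℝ → ℝ} (hf : Continuous f) {s t β : ℝ}
    (hne : ∀ x ∈ uIcc s t, f x ≠ β) (hs : f s < β) : f t < β := by
  by_contra! hcon
  obtain ⟨x, hx, hxe⟩ := intermediate_value_uIcc (hf.continuousOn (s := uIcc s t))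
    (show β ∈ uIcc (f s) (f t) from mem_uIcc.2 (Or.inl ⟨hs.le, hcon⟩))
  exact hne x hx hxe

/-- A planar zero theorem of Poincaré–Miranda type, in which the sign of the second component
on the vertical sides only matters where the first component vanishes. -/
theorem exists_zero_or_boundary {F₁ F₂ : ℝ × ℝ → ℝ} (h₁ : Continuous F₁) (h₂ : Continuous F₂)
    {b : ℝ} (hb : 0 < b) :
    ∃ p ∈ Icc (0 : ℝ) 1, ∃ q ∈ Icc (-b) b,
      (F₁ (p, q) = 0 ∧ F₂ (p, q) = 0) ∨ (q = b ∧ F₁ (p, q) ≤ 0) ∨ (q = -b ∧ 0 ≤ F₁ (p, q)) ∨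
      (p = 0 ∧ F₁ (p, q) = 0 ∧ F₂ (p, q) ≤ 0) ∨ (p = 1 ∧ F₁ (p, q) = 0 ∧ 0 ≤ F₂ (p, q)) := by
  by_contra! hcon
  have hpr : Continuous fun x : ℝ × ℝ => (max 0 (min x.1 1), max (-b) (min x.2 b)) := by fun_prop
  obtain ⟨R, θ, hθ, hR⟩ := exists_continuous_arg (h₁.comp hpr) (h₂.comp hpr) (by
    intro x
    by_contra! h0
    exact (hcon (max 0 (min x.1 1)) ⟨le_max_left _ _, by simp⟩
      (max (-b) (min x.2 b)) ⟨le_max_left _ _, by simp [hb.le]⟩).1 h0.1 h0.2)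
  have key : ∀ p ∈ Icc (0 : ℝ) 1, ∀ q ∈ Icc (-b) b, 0 < R (p, q) ∧
      F₁ (p, q) = R (p, q) * Real.cos (θ (p, q)) ∧
      F₂ (p, q) = R (p, q) * Real.sin (θ (p, q)) := by
    intro p hp q hq
    have := hR (p, q)
    simpa [hp.1, hp.2, hq.1, hq.2] using this
  have hbb : b ∈ Icc (-b) b := ⟨by linarith, le_rfl⟩
  have hnb : -b ∈ Icc (-b) b := ⟨le_rfl, by linarith⟩
  have h0 : (0 : ℝ) ∈ Icc (0 : ℝ) 1 := by simp
  have h1 : (1 : ℝ) ∈ Icc (0 : ℝ) 1 := by simp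
  have top : ∀ p ∈ Icc (0 : ℝ) 1, 0 < Real.cos (θ (p, b)) := by
    intro p hp
    have h := (hcon p hp b hbb).2.1 rfl
    obtain ⟨hr, e, -⟩ := key p hp b hbb
    rw [e] at h
    exact pos_of_mul_pos_right h hr.le
  have bot : ∀ p ∈ Icc (0 : ℝ) 1, Real.cos (θ (p, -b)) < 0 := by
    intro p hp
    have h := (hcon p hp (-b) hnb).2.2.1 rfl
    obtain ⟨hr, e, -⟩ := key p hp (-b) hnb
    rw [e] at h
    by_contra! h'
    nlinarith [mul_nonneg hr.le h']
  have left : ∀ q ∈ Icc (-b) b, Real.cos (θ (0, q)) = 0 → 0 < Real.sin (θ (0, q)) := by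
    intro q hq hcos
    obtain ⟨hr, e, e'⟩ := key 0 h0 q hq
    have h := (hcon 0 h0 q hq).2.2.2.1 rfl (by rw [e, hcos, mul_zero])
    rw [e'] at h
    exact pos_of_mul_pos_right h hr.le
  have right : ∀ q ∈ Icc (-b) b, Real.cos (θ (1, q)) = 0 → Real.sin (θ (1, q)) < 0 := by
    intro q hq hcos
    obtain ⟨hr, e, e'⟩ := key 1 h1 q hq
    have h := (hcon 1 h1 q hq).2.2.2.2 rfl (by rw [e, hcos, mul_zero])
    rw [e'] at h
    by_contra! h'
    nlinarith [mul_nonneg hr.le h']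
  obtain ⟨k, hk⟩ : ∃ k : ℤ, |θ (0, b) - k * (2 * Real.pi)| < Real.pi / 2 := by
    refine ⟨round (θ (0, b) / (2 * Real.pi)), ?_⟩
    set k := round (θ (0, b) / (2 * Real.pi)) with hkdef
    have hr := abs_sub_round (θ (0, b) / (2 * Real.pi))
    rw [← hkdef] at hr
    have hpi := Real.pi_pos
    have e : θ (0, b) - k * (2 * Real.pi) = (θ (0, b) / (2 * Real.pi) - k) * (2 * Real.pi) := by
      field_simp
    have hle : |θ (0, b) - k * (2 * Real.pi)| ≤ Real.pi := by
      rw [e, abs_mul, abs_of_pos (by positivity : 0 < 2 * Real.pi)]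
      nlinarith
    by_contra! hge
    have hcos := top 0 h0
    rw [← Real.cos_sub_int_mul_two_pi _ k, ← Real.cos_abs] at hcos
    exact absurd hcos (not_lt.2 (Real.cos_nonpos_of_pi_div_two_le_of_le hge (by linarith)))
  set α : ℝ := k * (2 * Real.pi) with hα
  have cosα : ∀ x, Real.cos (α + x) = Real.cos x := fun x => by
    rw [hα, add_comm, Real.cos_add_int_mul_two_pi]
  have sinα : ∀ x, Real.sin (α + x) = Real.sin x := fun x => by
    rw [hα, add_comm, Real.sin_add_int_mul_two_pi]
  obtain ⟨hk1, hk2⟩ := abs_lt.1 hk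
  have cp : Real.cos (α + Real.pi / 2) = 0 := by rw [cosα, Real.cos_pi_div_two]
  have cm : Real.cos (α + -(Real.pi / 2)) = 0 := by
    rw [cosα, Real.cos_neg, Real.cos_pi_div_two]
  have t1 : θ (1, b) < α + Real.pi / 2 := by
    refine lt_of_forall_ne (f := fun p => θ (p, b)) (by fun_prop) (s := 0) ?_ (by linarith)
    intro p hp e
    have := top p (by simpa [uIcc_of_le] using hp)
    rw [e, cp] at this
    exact lt_irrefl _ this
  have t2 : θ (1, -b) < α + Real.pi / 2 := by
    refine lt_of_forall_ne (f := fun q => θ (1, q)) (by fun_prop) (s := b) ?_ t1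
    intro q hq e
    rw [uIcc_of_ge (by linarith)] at hq
    have := right q hq (by rw [e, cp])
    rw [e, sinα, Real.sin_pi_div_two] at this
    linarith
  have t3 : -θ (0, -b) < -(α + -(Real.pi / 2)) := by
    refine lt_of_forall_ne (f := fun q => -θ (0, q)) (by fun_prop) (s := b) ?_ (by linarith)
    intro q hq e
    have e := neg_injective e
    rw [uIcc_of_ge (by linarith)] at hq
    have := left q hq (by rw [e, cm])
    rw [e, sinα, Real.sin_neg, Real.sin_pi_div_two] at this
    linarith
  have t4 : -θ (0, -b) < -(α + Real.pi / 2) := by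
    by_contra! h'
    have hneg := bot 0 h0
    rw [← add_sub_cancel α (θ (0, -b)), cosα] at hneg
    exact absurd hneg (not_lt.2 (Real.cos_nonneg_of_mem_Icc ⟨by linarith, by linarith⟩))
  have t5 : -θ (1, -b) < -(α + Real.pi / 2) := by
    refine lt_of_forall_ne (f := fun p => -θ (p, -b)) (by fun_prop) (s := 0) ?_ t4
    intro p hp e
    have e := neg_injective e
    have := bot p (by simpa [uIcc_of_le] using hp)
    rw [e, cp] at this
    exact lt_irrefl _ this
  linarith

theorem lt_of_bootstrap {f : ℝ → ℝ} (hf : Continuous f) {p q β : ℝ} (h0 : f p < β)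
    (step : ∀ t ∈ Icc p q, (∀ s ∈ Icc p t, f s ≤ β) → f t < β) : ∀ t ∈ Icc p q, f t < β := by
  intro t ht
  by_contra! hcon
  have hne : (Icc p t ∩ f ⁻¹' {β}).Nonempty := by
    obtain ⟨x, hx, hxe⟩ := intermediate_value_Icc ht.1 hf.continuousOn ⟨h0.le, hcon⟩
    exact ⟨x, hx, hxe⟩
  obtain ⟨s, ⟨hs, hse⟩, hmin⟩ :=
    (isCompact_Icc.inter_right (isClosed_singleton.preimage hf)).exists_isLeast hne
  refine (step s ⟨hs.1, hs.2.trans ht.2⟩ fun r hr => ?_).ne hse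
  by_contra! hgt
  obtain ⟨x, hx, hxe⟩ := intermediate_value_Icc hr.1 hf.continuousOn ⟨h0.le, hgt.le⟩
  have hsx : s ≤ x := hmin ⟨⟨hx.1, hx.2.trans (hr.2.trans hs.2)⟩, hxe⟩
  have : x = r := le_antisymm hx.2 (hr.2.trans hsx)
  rw [this] at hxe
  exact hgt.ne' hxe

namespace PlanarSol

variable {b h u v : ℝ → ℝ} {p q : ℝ}

theorem reverse (S : PlanarSol b h p q u v) :
    PlanarSol (fun t => b (-t)) h (-q) (-p) (fun t => u (-t)) (fun t => -v (-t)) := by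
  refine ⟨S.cu.comp continuous_neg, (S.cv.comp continuous_neg).neg, fun s hs t ht => ?_,
    fun s hs t ht => ?_⟩
  · rw [S.eu (-s) ⟨by linarith [hs.2], by linarith [hs.1]⟩ (-t)
      ⟨by linarith [ht.2], by linarith [ht.1]⟩]
    simp only [relVel_neg, intervalIntegral.integral_neg,
      intervalIntegral.integral_comp_neg (fun x => relVel (v x))]
    rw [intervalIntegral.integral_symm]
  · have := S.ev (-s) ⟨by linarith [hs.2], by linarith [hs.1]⟩ (-t)
      ⟨by linarith [ht.2], by linarith [ht.1]⟩
    rw [intervalIntegral.integral_comp_neg (fun x => b x * h (u x)),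
      intervalIntegral.integral_symm]
    linarith

theorem sub_le_of_relVel_le (S : PlanarSol b h p q u v) {s t κ : ℝ} (hs : p ≤ s) (hst : s ≤ t)
    (ht : t ≤ q) (H : ∀ x ∈ Icc s t, relVel (v x) ≤ κ) : u t - u s ≤ κ * (t - s) := by
  rw [S.eu s ⟨hs, hst.trans ht⟩ t ⟨hs.trans hst, ht⟩]
  have := intervalIntegral.integral_mono_on hst
    ((continuous_relVel.comp S.cv).intervalIntegrable (μ := volume) s t)
    intervalIntegrable_const H
  simpa [mul_comm] using this

theorem le_sub_of_le_relVel (S : PlanarSol b h p q u v) {s t κ : ℝ} (hs : p ≤ s) (hst : s ≤ t)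
    (ht : t ≤ q) (H : ∀ x ∈ Icc s t, κ ≤ relVel (v x)) : κ * (t - s) ≤ u t - u s := by
  rw [S.eu s ⟨hs, hst.trans ht⟩ t ⟨hs.trans hst, ht⟩]
  have := intervalIntegral.integral_mono_on hst (intervalIntegrable_const (μ := volume))
    ((continuous_relVel.comp S.cv).intervalIntegrable s t) H
  simpa [mul_comm] using this

theorem abs_sub_le_of_abs_le (S : PlanarSol b h p q u v) {s t κ : ℝ} (hs : p ≤ s) (hst : s ≤ t)
    (ht : t ≤ q) (H : ∀ x ∈ Icc s t, |v x| ≤ κ) : |u t - u s| ≤ κ * (t - s) := by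
  have H' : ∀ x ∈ Icc s t, |relVel (v x)| ≤ κ := fun x hx => (abs_relVel_le_abs _).trans (H x hx)
  rw [abs_le]
  constructor
  · have := S.le_sub_of_le_relVel hs hst ht fun x hx => (abs_le.1 (H' x hx)).1
    linarith
  · exact S.sub_le_of_relVel_le hs hst ht fun x hx => (abs_le.1 (H' x hx)).2

theorem lt_of_velocity_pos (S : PlanarSol b h p q u v) {s t : ℝ} (hs : p ≤ s) (hst : s < t)
    (ht : t ≤ q) (H : ∀ x ∈ Icc s t, 0 < v x) : u s < u t := by
  rw [← sub_pos, S.eu s ⟨hs, hst.le.trans ht⟩ t ⟨hs.trans hst.le, ht⟩]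
  exact intervalIntegral.intervalIntegral_pos_of_pos_on
    ((continuous_relVel.comp S.cv).intervalIntegrable _ _)
    (fun x hx => relVel_pos (H x (Ioo_subset_Icc_self hx))) hst

theorem lt_of_velocity_neg (S : PlanarSol b h p q u v) {s t : ℝ} (hs : p ≤ s) (hst : s < t)
    (ht : t ≤ q) (H : ∀ x ∈ Icc s t, v x < 0) : u t < u s := by
  have := S.reverse.lt_of_velocity_pos (s := -t) (t := -s) (by linarith) (by linarith)
    (by linarith) fun x hx => neg_pos.2 (H (-x) ⟨by linarith [hx.2], by linarith [hx.1]⟩)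
  simpa using this

theorem abs_momentum_sub_le (S : PlanarSol b h p q u v)
    (hb : ∀ p q, IntervalIntegrable b volume p q) {s t D : ℝ} (hD : 0 ≤ D)
    (hs : p ≤ s) (hst : s ≤ t) (ht : t ≤ q) (H : ∀ x ∈ Icc s t, |h (u x)| ≤ D) :
    |v t - v s| ≤ (∫ x in p..q, |b x|) * D := by
  rw [S.ev s ⟨hs, hst.trans ht⟩ t ⟨hs.trans hst, ht⟩, abs_neg, ← Real.norm_eq_abs]
  calc ‖∫ x in s..t, b x * h (u x)‖ ≤ ∫ x in s..t, |b x| * D := by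
        refine intervalIntegral.norm_integral_le_of_norm_le hst
          (Eventually.of_forall fun x hx => ?_) ((hb s t).abs.mul_const D)
        rw [norm_mul]
        exact mul_le_mul_of_nonneg_left (H x (Ioc_subset_Icc_self hx)) (norm_nonneg _)
    _ = (∫ x in s..t, |b x|) * D := intervalIntegral.integral_mul_const _ _
    _ ≤ _ := by
        refine mul_le_mul_of_nonneg_right ?_ hD
        exact intervalIntegral.integral_mono_interval hs hst ht
          (Eventually.of_forall fun x => abs_nonneg _) (hb p q).abs

theorem momentum_eq_of_nonpos (S : PlanarSol b h p q u v) (hneg : ∀ s ≤ 0, h s = 0) {s t : ℝ}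
    (hs : p ≤ s) (hst : s ≤ t) (ht : t ≤ q) (H : ∀ x ∈ Icc s t, u x ≤ 0) : v t = v s := by
  have h1 := S.ev s ⟨hs, hst.trans ht⟩ t ⟨hs.trans hst, ht⟩
  have h2 : ∫ x in s..t, b x * h (u x) = ∫ x in s..t, (0 : ℝ) := by
    apply intervalIntegral.integral_congr
    intro x hx
    rw [uIcc_of_le hst] at hx
    simp [hneg _ (H x hx)]
  rw [h2, intervalIntegral.integral_zero] at h1
  linarith

theorem forward_of_neg (S : PlanarSol b h p q u v) (hneg : ∀ s ≤ 0, h s = 0) {s : ℝ}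
    (hs : p ≤ s) (hu : u s < 0) (hv : v s ≤ 0) :
    ∀ t ∈ Icc s q, u t ≤ u s ∧ v t = v s := by
  have aux : ∀ t ∈ Icc s q, (∀ x ∈ Icc s t, u x ≤ 0) → u t ≤ u s := by
    intro t ht hx
    have := S.sub_le_of_relVel_le hs ht.1 ht.2 (κ := 0) fun x hx' => by
      rw [S.momentum_eq_of_nonpos hneg hs hx'.1 (hx'.2.trans ht.2) fun y hy =>
        hx y ⟨hy.1, hy.2.trans hx'.2⟩]
      exact relVel_nonpos hv
    linarith
  have hlt := lt_of_bootstrap S.cu hu (q := q) fun t ht hx => (aux t ht hx).trans_lt hu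
  intro t ht
  have hle : ∀ x ∈ Icc s t, u x ≤ 0 := fun x hx => (hlt x ⟨hx.1, hx.2.trans ht.2⟩).le
  exact ⟨aux t ht hle, S.momentum_eq_of_nonpos hneg hs ht.1 ht.2 hle⟩

theorem backward_of_neg (S : PlanarSol b h p q u v) (hneg : ∀ s ≤ 0, h s = 0) {s : ℝ}
    (hs : s ≤ q) (hu : u s < 0) (hv : 0 ≤ v s) :
    ∀ t ∈ Icc p s, u t ≤ u s ∧ v t = v s := by
  intro t ht
  have := S.reverse.forward_of_neg hneg (s := -s) (by linarith) (by simpa) (by simpa) (-t)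
    ⟨by linarith [ht.2], by linarith [ht.1]⟩
  simpa using this

theorem nonneg_of_pos_endpoints (S : PlanarSol b h p q u v) (hneg : ∀ s ≤ 0, h s = 0)
    (hp : 0 < u p) (hq : 0 < u q) : ∀ t ∈ Icc p q, 0 ≤ u t := by
  intro t ht
  by_contra! hcon
  rcases le_total (v t) 0 with hv | hv
  · linarith [(S.forward_of_neg hneg ht.1 hcon hv q ⟨ht.2, le_rfl⟩).1]
  · linarith [(S.backward_of_neg hneg ht.2 hcon hv p ⟨le_rfl, ht.1⟩).1]

theorem nonneg_of_periodic (S : PlanarSol b h p q u v) (hneg : ∀ s ≤ 0, h s = 0)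
    (hpq : p < q) (hu : u q = u p) (hv : v q = v p) (h0 : 0 < u p ∨ v p ≠ 0) :
    ∀ t ∈ Icc p q, 0 ≤ u t := by
  intro t ht
  by_contra! hcon
  have absurd_of_const : u p < 0 → (∀ x ∈ Icc p q, v x = v p) → False := by
    intro hup hc
    rcases h0 with h0 | h0
    · linarith
    · rcases lt_or_gt_of_ne h0 with h0 | h0
      · exact (S.lt_of_velocity_neg le_rfl hpq le_rfl fun x hx => by rw [hc x hx]; exact h0).ne hu
      · exact (S.lt_of_velocity_pos le_rfl hpq le_rfl fun x hx => by rw [hc x hx]; exact h0).ne' hu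
  rcases le_total (v t) 0 with hvt | hvt
  · obtain ⟨h1, h2⟩ := S.forward_of_neg hneg ht.1 hcon hvt q ⟨ht.2, le_rfl⟩
    have hup : u p < 0 := by linarith
    exact absurd_of_const hup fun x hx =>
      (S.forward_of_neg hneg le_rfl hup (by linarith) x hx).2
  · obtain ⟨h1, h2⟩ := S.backward_of_neg hneg ht.2 hcon hvt p ⟨le_rfl, ht.1⟩
    have huq : u q < 0 := by linarith
    exact absurd_of_const (by linarith) fun x hx => by
      rw [(S.backward_of_neg hneg le_rfl huq (by linarith) x hx).2, hv]

/-- A priori bounds for solutions remaining in a region where `h` is small. -/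
theorem abs_sub_lt_of_small (S : PlanarSol b h p q u v)
    (hb : ∀ p q, IntervalIntegrable b volume p q) {η M D : ℝ} (hη : 0 < η) (hD : 0 ≤ D)
    (hM : u p + (|v p| + η) * (q - p) ≤ M) (hh : ∀ s ≤ M, |h s| ≤ D)
    (hK : (∫ x in p..q, |b x|) * D < η) :
    ∀ t ∈ Icc p q, |v t - v p| < η ∧ |u t - u p| ≤ (|v p| + η) * (q - p) := by
  have aux : ∀ t ∈ Icc p q, (∀ x ∈ Icc p t, |v x - v p| ≤ η) →
      |u t - u p| ≤ (|v p| + η) * (q - p) := by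
    intro t ht hx
    have hnn : 0 ≤ |v p| + η := by positivity
    refine (S.abs_sub_le_of_abs_le le_rfl ht.1 ht.2 (κ := |v p| + η) fun x hx' => ?_).trans
      (mul_le_mul_of_nonneg_left (by linarith [ht.2]) hnn)
    have h1 := abs_add_le (v p) (v x - v p)
    rw [add_sub_cancel] at h1
    linarith [hx x hx']
  have hlt := lt_of_bootstrap (f := fun t => |v t - v p|) (p := p) (q := q) (β := η)
    (S.cv.sub continuous_const).abs (by simpa using hη) fun t ht hx => by
      refine (S.abs_momentum_sub_le hb hD le_rfl ht.1 ht.2 fun x hx' => hh _ ?_).trans_lt hK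
      have := (abs_le.1 (aux x ⟨hx'.1, hx'.2.trans ht.2⟩ fun y hy =>
        hx y ⟨hy.1, hy.2.trans hx'.2⟩)).2
      linarith
  exact fun t ht => ⟨hlt t ht, aux t ht fun x hx => (hlt x ⟨hx.1, hx.2.trans ht.2⟩).le⟩

/-- Forward uniqueness of the zero solution when `h s = o(s)`. -/
theorem eq_zero_of_initial_zero (S : PlanarSol b h p q u v)
    (hb : ∀ p q, IntervalIntegrable b volume p q) (hpq : p ≤ q)
    (hsmall : ∀ ε > 0, ∃ s₀ > 0, ∀ s ≤ s₀, |h s| ≤ ε * max s 0)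
    (hu : u p = 0) (hv : v p = 0) : ∀ t ∈ Icc p q, u t = 0 := by
  intro t ht
  have hK : 0 ≤ ∫ x in p..q, |b x| :=
    intervalIntegral.integral_nonneg hpq fun x _ => abs_nonneg _
  set K := ∫ x in p..q, |b x| with hKdef
  have hL : 0 ≤ q - p := by linarith
  obtain ⟨s₀, hs₀, hs⟩ := hsmall (1 / (K * (q - p) + 1)) (by positivity)
  have hvle : ∀ η > 0, η * (q - p) ≤ s₀ → |u t| ≤ η * (q - p) := by
    intro η hη hηs
    have hKD : K * (1 / (K * (q - p) + 1) * (η * (q - p))) < η := by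
      have e : K * (1 / (K * (q - p) + 1) * (η * (q - p))) =
          η * (K * (q - p)) / (K * (q - p) + 1) := by field_simp
      rw [e, div_lt_iff₀ (by positivity)]
      nlinarith
    have := (S.abs_sub_lt_of_small hb hη (M := η * (q - p))
      (D := 1 / (K * (q - p) + 1) * (η * (q - p))) (by positivity) (by simp [hu, hv])
      (fun s hsM => (hs s (hsM.trans hηs)).trans (mul_le_mul_of_nonneg_left
        (max_le hsM (by positivity)) (by positivity))) hKD t ht).2
    simpa [hu, hv] using this
  by_contra hne
  have hpos : 0 < |u t| := abs_pos.2 hne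
  set η := min (s₀ / (q - p + 1)) (|u t| / (2 * (q - p + 1)))
  have hη : 0 < η := by positivity
  have h1 : η * (q - p + 1) ≤ s₀ := (le_div_iff₀ (by positivity)).1 (min_le_left _ _)
  have h2 : η * (2 * (q - p + 1)) ≤ |u t| := (le_div_iff₀ (by positivity)).1 (min_le_right _ _)
  have h3 := hvle η hη (by nlinarith)
  nlinarith

/-- A solution with periodic position close to zero has increasing momentum over a period when the
weight has negative mean and `h` is almost constant under small relative perturbations. -/
theorem momentum_lt_of_small (S : PlanarSol b h p q u v) (hpq : p < q)
    (hb : ∀ p q, IntervalIntegrable b volume p q) (hh : Continuous h)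
    {r ε δ κ : ℝ} (hr : 0 < r) (hhr : 0 < h r) (hε : 0 ≤ ε)
    (hup : u p = r) (huq : u q = r) (hnn : ∀ t ∈ Icc p q, 0 ≤ u t)
    (hlin : ∀ t ∈ Icc p q, |h (u t)| ≤ ε * u t)
    (hε1 : (∫ x in p..q, |b x|) * ε * (q - p) ≤ 1 / 2)
    (hε2 : 2 * ((∫ x in p..q, |b x|) * ε * (q - p)) ≤ δ)
    (hosc : ∀ s, |s - r| ≤ δ * r → |h s - h r| ≤ κ * h r)
    (hκ : κ * (∫ x in p..q, |b x|) < -∫ x in p..q, b x) : v p < v q := by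
  have hK : 0 ≤ ∫ x in p..q, |b x| :=
    intervalIntegral.integral_nonneg hpq.le fun x _ => abs_nonneg _
  set K := ∫ x in p..q, |b x| with hKdef
  obtain ⟨m, hm, hmax⟩ := isCompact_Icc.exists_isMaxOn (nonempty_Icc.2 hpq.le) S.cu.continuousOn
  have hmax : ∀ t ∈ Icc p q, u t ≤ u m := fun t ht => hmax ht
  have hM0 : 0 ≤ u m := hnn m hm
  obtain ⟨τ, hτ, hτ0⟩ : ∃ τ ∈ Icc p q, v τ = 0 := by
    have h1 : ∃ x ∈ Icc p q, v x ≤ 0 := by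
      by_contra! hc
      exact (S.lt_of_velocity_pos le_rfl hpq le_rfl hc).ne (by rw [hup, huq])
    have h2 : ∃ x ∈ Icc p q, 0 ≤ v x := by
      by_contra! hc
      exact (S.lt_of_velocity_neg le_rfl hpq le_rfl hc).ne (by rw [hup, huq])
    obtain ⟨x, hx, hx0⟩ := h1
    obtain ⟨y, hy, hy0⟩ := h2
    obtain ⟨z, hz, hz0⟩ := isPreconnected_Icc.intermediate_value hx hy S.cv.continuousOn
      ⟨hx0, hy0⟩
    exact ⟨z, hz, hz0⟩
  have hD : ∀ x ∈ Icc p q, |h (u x)| ≤ ε * u m := fun x hx =>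
    (hlin x hx).trans (mul_le_mul_of_nonneg_left (hmax x hx) hε)
  have hv : ∀ t ∈ Icc p q, |v t| ≤ K * (ε * u m) := by
    intro t ht
    rcases le_total τ t with h' | h'
    · have := S.abs_momentum_sub_le hb (D := ε * u m) (by positivity) hτ.1 h' ht.2 fun x hx =>
        hD x ⟨hτ.1.trans hx.1, hx.2.trans ht.2⟩
      rwa [hτ0, sub_zero] at this
    · have := S.abs_momentum_sub_le hb (D := ε * u m) (by positivity) ht.1 h' hτ.2 fun x hx =>
        hD x ⟨ht.1.trans hx.1, hx.2.trans hτ.2⟩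
      rwa [hτ0, zero_sub, abs_neg] at this
  have hu : ∀ t ∈ Icc p q, |u t - r| ≤ K * (ε * u m) * (q - p) := by
    intro t ht
    rw [← hup]
    refine (S.abs_sub_le_of_abs_le le_rfl ht.1 ht.2 fun x hx =>
      hv x ⟨hx.1, hx.2.trans ht.2⟩).trans ?_
    exact mul_le_mul_of_nonneg_left (by linarith [ht.2]) (by positivity)
  have hum : u m ≤ 2 * r := by
    have h1 := (abs_le.1 (hu m hm)).2
    have h2 : K * (ε * u m) * (q - p) = (K * ε * (q - p)) * u m := by ring
    rw [h2] at h1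
    nlinarith
  have hosc' : ∀ t ∈ Icc p q, |h (u t) - h r| ≤ κ * h r := by
    intro t ht
    refine hosc _ ((hu t ht).trans ?_)
    have h2 : K * (ε * u m) * (q - p) = (K * ε * (q - p)) * u m := by ring
    have h3 : 0 ≤ K * ε * (q - p) := by
      have : 0 ≤ q - p := by linarith
      positivity
    rw [h2]
    nlinarith
  have hev := S.ev p ⟨le_rfl, hpq.le⟩ q ⟨hpq.le, le_rfl⟩
  have hi : IntervalIntegrable (fun x => b x * (h (u x) - h r)) volume p q :=
    intervalIntegrable_mul_of_continuous hb ((hh.comp S.cu).sub continuous_const) p q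
  have hsplit : ∫ x in p..q, b x * h (u x) =
      (∫ x in p..q, b x) * h r + ∫ x in p..q, b x * (h (u x) - h r) := by
    rw [← intervalIntegral.integral_mul_const,
      ← intervalIntegral.integral_add ((hb p q).mul_const (h r)) hi]
    congr 1
    funext x
    ring
  have hbound : ∫ x in p..q, b x * (h (u x) - h r) ≤ K * (κ * h r) := by
    rw [hKdef, ← intervalIntegral.integral_mul_const]
    refine intervalIntegral.integral_mono_on hpq.le hi ((hb p q).abs.mul_const _) fun x hx => ?_
    refine (le_abs_self _).trans ?_
    rw [abs_mul]
    exact mul_le_mul_of_nonneg_left (hosc' x hx) (abs_nonneg _)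
  nlinarith

theorem momentum_le_of_weight_nonneg (S : PlanarSol b h p q u v) (hh : ∀ s, 0 ≤ h s)
    {s t : ℝ} (hs : p ≤ s) (hst : s ≤ t) (ht : t ≤ q)
    (hbn : ∀ᵐ x, x ∈ Icc s t → 0 ≤ b x) : v t ≤ v s := by
  have h1 := S.ev s ⟨hs, hst.trans ht⟩ t ⟨hs.trans hst, ht⟩
  have h2 : 0 ≤ ∫ x in s..t, b x * h (u x) := by
    refine intervalIntegral.integral_nonneg_of_ae_restrict hst ?_
    rw [EventuallyLE, ae_restrict_iff' measurableSet_Icc]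
    filter_upwards [hbn] with x hx hxm
    exact mul_nonneg (hx hxm) (hh _)
  linarith

/-- A solution of small height on a large positive hump of the weight loses momentum. -/
theorem momentum_lt_of_large_weight (S : PlanarSol b h p q u v)
    (hb : ∀ p q, IntervalIntegrable b volume p q) (hh : Continuous h) (hh0 : ∀ s, 0 ≤ h s)
    {ℓ m : ℝ} (hℓ : 0 < ℓ) (hℓq : ℓ ≤ q - p)
    (hb1 : ∀ᵐ x, x ∈ Icc p (p + ℓ) → 0 ≤ b x) (hb2 : ∀ᵐ x, x ∈ Icc (q - ℓ) q → 0 ≤ b x)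
    (hm : ∀ s ∈ Icc (ℓ / 16) (ℓ / 4), m ≤ h s)
    (hlarge : 2 < m * ∫ x in p..(p + ℓ / 8), b x)
    (hup : u p = ℓ / 8) (huq : u q = ℓ / 8) (hnn : ∀ t ∈ Icc p q, 0 ≤ u t) : v q < v p := by
  by_contra! hcon
  have dec1 : ∀ s t, p ≤ s → s ≤ t → t ≤ p + ℓ → v t ≤ v s := fun s t hs hst ht =>
    S.momentum_le_of_weight_nonneg hh0 hs hst (by linarith) (hb1.mono fun x hx hxm =>
      hx ⟨hs.trans hxm.1, hxm.2.trans ht⟩)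
  have dec2 : ∀ s, q - ℓ ≤ s → s ≤ q → v q ≤ v s := fun s hs hsq =>
    S.momentum_le_of_weight_nonneg hh0 (by linarith) hsq le_rfl (hb2.mono fun x hx hxm =>
      hx ⟨hs.trans hxm.1, hxm.2⟩)
  have mono := strictMono_relVel.monotone
  have hvp : relVel (v p) ≤ 1 / 8 := by
    have h1 := S.le_sub_of_le_relVel (s := q - ℓ) (t := q) (κ := relVel (v p)) (by linarith)
      (by linarith) le_rfl fun x hx => mono (hcon.trans (dec2 x hx.1 hx.2))
    have h2 := hnn (q - ℓ) ⟨by linarith, by linarith⟩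
    have h3 : relVel (v p) * ℓ ≤ 1 / 8 * ℓ := by nlinarith
    exact le_of_mul_le_mul_right h3 hℓ
  have hup' : ∀ t ∈ Icc p (p + ℓ), u t ≤ ℓ / 4 := by
    intro t ht
    have h1 := S.sub_le_of_relVel_le (s := p) (t := t) (κ := 1 / 8) le_rfl ht.1
      (by linarith [ht.2]) fun x hx => (mono (dec1 p x le_rfl hx.1 (hx.2.trans ht.2))).trans hvp
    linarith [ht.2]
  have hvm : -(1 / 2) ≤ relVel (v (p + ℓ / 2)) := by
    have h1 := S.sub_le_of_relVel_le (s := p + ℓ / 2) (t := p + ℓ)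
      (κ := relVel (v (p + ℓ / 2))) (by linarith) (by linarith) (by linarith) fun x hx =>
        mono (dec1 _ x (by linarith) hx.1 hx.2)
    have h2 := hnn (p + ℓ) ⟨by linarith, by linarith⟩
    have h3 := hup' (p + ℓ / 2) ⟨by linarith, by linarith⟩
    have h4 : -(1 / 2) * (ℓ / 2) ≤ relVel (v (p + ℓ / 2)) * (ℓ / 2) := by nlinarith
    exact le_of_mul_le_mul_right h4 (by linarith)
  have hlow : ∀ t ∈ Icc p (p + ℓ / 8), ℓ / 16 ≤ u t := by
    intro t ht
    have h1 := S.le_sub_of_le_relVel (s := p) (t := t) (κ := -(1 / 2)) le_rfl ht.1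
      (by linarith [ht.2]) fun x hx =>
        hvm.trans (mono (dec1 x _ hx.1 (by linarith [hx.2, ht.2]) (by linarith)))
    linarith [ht.2]
  have h1 : v p ≤ 1 := by
    by_contra! h'
    linarith [strictMono_relVel h', half_lt_relVel_one]
  have h2 : -1 ≤ v (p + ℓ / 8) := by
    by_contra! h'
    have h3 := strictMono_relVel h'
    rw [relVel_neg] at h3
    have h4 := mono (dec1 (p + ℓ / 8) (p + ℓ / 2) (by linarith) (by linarith) (by linarith))
    linarith [half_lt_relVel_one]
  have h3 := S.ev p ⟨le_rfl, by linarith⟩ (p + ℓ / 8) ⟨by linarith, by linarith⟩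
  have h4 : m * ∫ x in p..(p + ℓ / 8), b x ≤ ∫ x in p..(p + ℓ / 8), b x * h (u x) := by
    rw [← intervalIntegral.integral_const_mul]
    refine intervalIntegral.integral_mono_ae_restrict (by linarith) ((hb _ _).const_mul m)
      (intervalIntegrable_mul_of_continuous hb (hh.comp S.cu) _ _) ?_
    rw [EventuallyLE, ae_restrict_iff' measurableSet_Icc]
    filter_upwards [hb1] with x hx hxm
    rw [mul_comm]
    exact mul_le_mul_of_nonneg_left (hm _ ⟨hlow x hxm, hup' x ⟨hxm.1, by linarith [hxm.2]⟩⟩)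
      (hx ⟨hxm.1, by linarith [hxm.2]⟩)
  linarith

end PlanarSol

theorem PlanarSol.ne_of_abs_momentum_sub_lt {b h u v : ℝ → ℝ} {p q : ℝ}
    (S : PlanarSol b h p q u v) (hpq : p < q) (H : ∀ t ∈ Icc p q, |v t - v p| < |v p|) :
    u q ≠ u p := by
  rcases le_total 0 (v p) with hv | hv
  · rw [abs_of_nonneg hv] at H
    exact (S.lt_of_velocity_pos le_rfl hpq le_rfl fun x hx => by
      linarith [(abs_lt.1 (H x hx)).1]).ne'
  · rw [abs_of_nonpos hv] at H
    exact (S.lt_of_velocity_neg le_rfl hpq le_rfl fun x hx => by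
      linarith [(abs_lt.1 (H x hx)).2]).ne

set_option maxHeartbeats 1000000 in
/-- Existence of a nontrivial solution of the truncated periodic boundary value problem. -/
theorem exists_periodic_planarSol {b h : ℝ → ℝ} {T ℓ m B : ℝ} (hT : 0 < T)
    (hb : ∀ p q, IntervalIntegrable b volume p q) (hh : Continuous h) (hB : ∀ s, |h s| ≤ B)
    (hh0 : ∀ s, 0 ≤ h s) (hneg : ∀ s ≤ 0, h s = 0) (hpos : ∀ s, 0 < s → 0 < h s)
    (hsmall : ∀ ε > 0, ∃ s₀ > 0, ∀ s ≤ s₀, |h s| ≤ ε * max s 0)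
    (hosc : ∀ κ > 0, ∃ δ > 0, ∃ r₀ > 0, ∀ r, 0 < r → r < r₀ → ∀ s, |s - r| ≤ δ * r →
      |h s - h r| ≤ κ * h r)
    (hbneg : ∫ x in (0 : ℝ)..T, b x < 0) (hℓ : 0 < ℓ) (hℓT : ℓ ≤ T)
    (hb1 : ∀ᵐ x, x ∈ Icc 0 ℓ → 0 ≤ b x) (hb2 : ∀ᵐ x, x ∈ Icc (T - ℓ) T → 0 ≤ b x)
    (hm : ∀ s ∈ Icc (ℓ / 16) (ℓ / 4), m ≤ h s)
    (hlarge : 2 < m * ∫ x in (0 : ℝ)..(ℓ / 8), b x) :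
    ∃ u v : ℝ → ℝ, PlanarSol b h 0 T u v ∧ u T = u 0 ∧ v T = v 0 ∧ (0 < u 0 ∨ v 0 ≠ 0) ∧
      u 0 ≤ ℓ / 8 := by
  have hB0 : 0 ≤ B := (abs_nonneg _).trans (hB 0)
  set K := ∫ x in (0 : ℝ)..T, |b x| with hKdef
  set I := ∫ x in (0 : ℝ)..T, b x with hIdef
  have hK : 0 < K := by
    have := intervalIntegral.abs_integral_le_integral_abs (f := b) (μ := volume) hT.le
    rw [← hKdef, ← hIdef, abs_of_neg hbneg] at this
    linarith
  obtain ⟨δ, hδ, r₀, hr₀, hosc⟩ := hosc (-I / (2 * K)) (div_pos (by linarith) (by positivity))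
  set ε := min δ 1 / (2 * K * (2 * T + 1)) with hεdef
  have hε : 0 < ε := by positivity
  have hεK : ε * (2 * K * (2 * T + 1)) = min δ 1 := div_mul_cancel₀ _ (by positivity)
  have hεδ : ε * (2 * K * (2 * T + 1)) ≤ δ := hεK.le.trans (min_le_left _ _)
  have hε1 : ε * (2 * K * (2 * T + 1)) ≤ 1 := hεK.le.trans (min_le_right _ _)
  have hKε : 0 < K * ε := by positivity
  have hKεT : 0 < K * ε * T := by positivity
  obtain ⟨s₀, hs₀, hlin⟩ := hsmall ε hε
  set η := s₀ / (2 * T + 1) with hηdef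
  have hη : 0 < η := by positivity
  have hηs : η * (2 * T + 1) = s₀ := div_mul_cancel₀ _ (by positivity)
  set r := min η (min (r₀ / 2) (ℓ / 8)) with hrdef
  have hr : 0 < r := by positivity
  have hrη : r ≤ η := min_le_left _ _
  have hrr : r ≤ r₀ / 2 := (min_le_right _ _).trans (min_le_left _ _)
  have hrℓ : r ≤ ℓ / 8 := (min_le_right _ _).trans (min_le_right _ _)
  set Y := K * B + 1 with hYdef
  have hY : 0 < Y := by positivity
  set R : ℝ → ℝ := fun p => (1 - p) * r + p * (ℓ / 8) with hR
  set P : ℝ → ℝ := fun p => (1 - p) * η + p * Y with hP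
  have hRpos : ∀ p ∈ Icc (0 : ℝ) 1, 0 < R p := by
    intro p hp
    have h1 : r ≤ R p := by simp only [hR]; nlinarith [hp.1]
    linarith
  have hRle : ∀ p ∈ Icc (0 : ℝ) 1, R p ≤ ℓ / 8 := by
    intro p hp
    simp only [hR]; nlinarith [hp.2]
  have hPpos : ∀ p ∈ Icc (0 : ℝ) 1, 0 < P p := by
    intro p hp
    simp only [hP]
    rcases hp.1.lt_or_eq with h | h
    · have := mul_nonneg (sub_nonneg.2 hp.2) hη.le
      have := mul_pos h hY
      linarith
    · rw [← h]; simpa using hη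
  set Ψ : ℝ × ℝ → ℝ × ℝ := fun x =>
    (R x.1 - (R x.1 + (T + 1)) * max (|x.2| - 1) 0 / 2, P x.1 * max (-1) (min 1 x.2)) with hΨdef
  have hΨ : Continuous Ψ := by
    simp only [hΨdef, hR, hP]
    fun_prop
  set S : Set ((ℝ × ℝ) × ℝ × ℝ) := {z | (z.2.1 = 0 ∧ z.2.2 = 0) ∨ (z.1.2 = 3 ∧ z.2.1 ≤ 0) ∨
    (z.1.2 = -3 ∧ 0 ≤ z.2.1) ∨ (z.1.1 = 0 ∧ z.2.1 = 0 ∧ z.2.2 ≤ 0) ∨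
    (z.1.1 = 1 ∧ z.2.1 = 0 ∧ 0 ≤ z.2.2)} with hSdef
  have hS : IsClosed S := by
    simp only [hSdef, ofPred_or, ofPred_and]
    refine .union (.inter (isClosed_eq ?_ ?_) (isClosed_eq ?_ ?_)) <|
      .union (.inter (isClosed_eq ?_ ?_) (isClosed_le ?_ ?_)) <|
      .union (.inter (isClosed_eq ?_ ?_) (isClosed_le ?_ ?_)) <|
      .union (.inter (isClosed_eq ?_ ?_) (.inter (isClosed_eq ?_ ?_) (isClosed_le ?_ ?_)))
        (.inter (isClosed_eq ?_ ?_) (.inter (isClosed_eq ?_ ?_) (isClosed_le ?_ ?_))) <;> fun_prop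
  obtain ⟨⟨p, q⟩, ⟨hp, hq⟩, u, v, sol, hu0, hv0, hmem⟩ :=
    exists_planarSol_of_forall_continuous hT hb hh hB
      (Q := Icc (0 : ℝ) 1 ×ˢ Icc (-3 : ℝ) 3) (isCompact_Icc.prod isCompact_Icc) hS hΨ
      fun F₁ F₂ h₁ h₂ => by
        obtain ⟨p, hp, q, hq, H⟩ := exists_zero_or_boundary h₁ h₂ (b := 3) (by norm_num)
        exact ⟨(p, q), ⟨hp, hq⟩, H⟩
  have hp : p ∈ Icc (0 : ℝ) 1 := hp
  have hq : q ∈ Icc (-3 : ℝ) 3 := hq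
  have hRp := hRpos p hp
  have hPp := hPpos p hp
  have hu0 : u 0 = R p - (R p + (T + 1)) * max (|q| - 1) 0 / 2 := hu0
  have hv0 : v 0 = P p * max (-1) (min 1 q) := hv0
  have hu0R : u 0 ≤ R p := by
    have : 0 ≤ (R p + (T + 1)) * max (|q| - 1) 0 := by positivity
    linarith
  have hin : |q| ≤ 1 → u 0 = R p := by
    intro h
    rw [hu0, max_eq_right (by linarith)]; ring
  have hout : 1 ≤ |q| → |v 0| = P p := by
    intro h
    rw [hv0, abs_mul, abs_of_pos hPp]
    rcases le_abs.1 h with h | h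
    · rw [min_eq_left h, max_eq_right (by norm_num), abs_one, mul_one]
    · rw [min_eq_right (by linarith), max_eq_left (by linarith), abs_neg, abs_one, mul_one]
  have hvle : |v 0| ≤ P p := by
    rw [hv0, abs_mul, abs_of_pos hPp]
    refine mul_le_of_le_one_right hPp.le (abs_le.2 ⟨le_max_left _ _, max_le (by norm_num) ?_⟩)
    exact min_le_left _ _
  have hend : |q| = 3 → ∀ t ∈ Icc 0 T, v t = v 0 := by
    intro h
    have hu : u 0 = -(T + 1) := by
      rw [hu0, h, max_eq_left (by norm_num)]; ring
    have hut : ∀ t ∈ Icc 0 T, u t ≤ 0 := by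
      intro t ht
      have := sol.sub_le_of_relVel_le le_rfl ht.1 ht.2 (κ := 1) fun x _ =>
        (le_abs_self _).trans (abs_relVel_le_one _)
      linarith [ht.2]
    exact fun t ht => sol.momentum_eq_of_nonpos hneg le_rfl ht.1 ht.2 fun x hx =>
      hut x ⟨hx.1, hx.2.trans ht.2⟩
  refine ⟨u, v, sol, ?_⟩
  have hcd : 0 < u 0 ∨ v 0 ≠ 0 := by
    rcases le_total |q| 1 with h | h
    · exact Or.inl (by rw [hin h]; exact hRp)
    · exact Or.inr (abs_pos.1 (by rw [hout h]; exact hPp))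
  have hmem : (u T - u 0 = 0 ∧ v T - v 0 = 0) ∨ (q = 3 ∧ u T - u 0 ≤ 0) ∨
    (q = -3 ∧ 0 ≤ u T - u 0) ∨ (p = 0 ∧ u T - u 0 = 0 ∧ v T - v 0 ≤ 0) ∨
    (p = 1 ∧ u T - u 0 = 0 ∧ 0 ≤ v T - v 0) := hmem
  suffices u T - u 0 = 0 ∧ v T - v 0 = 0 from
    ⟨by linarith [this.1], by linarith [this.2], hcd, hu0R.trans (hRle p hp)⟩
  rcases hmem with h | ⟨rfl, h⟩ | ⟨rfl, h⟩ | ⟨rfl, h1, h2⟩ | ⟨rfl, h1, h2⟩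
  · exact h
  · have hv : 0 < v 0 := by rw [hv0]; norm_num; exact hPp
    have := sol.lt_of_velocity_pos le_rfl hT le_rfl fun x hx => by
      rw [hend (by norm_num) x hx]; exact hv
    linarith
  · have hv : v 0 < 0 := by rw [hv0]; norm_num; exact hPp
    have := sol.lt_of_velocity_neg le_rfl hT le_rfl fun x hx => by
      rw [hend (by norm_num) x hx]; exact hv
    linarith
  · exfalso
    have hR0 : R 0 = r := by simp [hR]
    have hP0 : P 0 = η := by simp [hP]
    rw [hR0] at hu0R hin
    rw [hP0] at hout hvle
    have hM : u 0 + (|v 0| + η) * (T - 0) ≤ s₀ := by nlinarith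
    have hKD : K * (ε * s₀) < η := by
      have e : K * (ε * s₀) = ε * (2 * K * (2 * T + 1)) * η / 2 := by rw [← hηs]; ring
      rw [e]
      nlinarith
    have hbd := sol.abs_sub_lt_of_small hb hη (D := ε * s₀) (by positivity) hM (fun s hs =>
      (hlin s hs).trans (mul_le_mul_of_nonneg_left (max_le hs hs₀.le) hε.le)) hKD
    rcases le_total |q| 1 with h | h
    · have hur := hin h
      have hnn := sol.nonneg_of_pos_endpoints hneg (by rw [hur]; exact hr) (by linarith)
      have := sol.momentum_lt_of_small hT hb hh (ε := ε) (δ := δ) (κ := -I / (2 * K)) hr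
        (hpos r hr) hε.le hur (by linarith) hnn
        (fun t ht => by
          have h3 := (abs_le.1 (hbd t ht).2).2
          have h4 := hlin (u t) (by linarith)
          rwa [max_eq_left (hnn t ht)] at h4)
        (by rw [← hKdef]; nlinarith) (by rw [← hKdef]; nlinarith)
        (hosc r hr (by linarith))
        (by
          rw [← hKdef, ← hIdef]
          have e : -I / (2 * K) * K = -I / 2 := by field_simp
          rw [e]; linarith)
      linarith
    · refine sol.ne_of_abs_momentum_sub_lt hT (fun t ht => ?_) (sub_eq_zero.1 h1)
      rw [hout h]
      exact (hbd t ht).1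
  · exfalso
    have hR1 : R 1 = ℓ / 8 := by simp [hR]
    have hP1 : P 1 = Y := by simp [hP]
    rw [hR1] at hin
    rw [hP1] at hout
    rcases le_total |q| 1 with h | h
    · have hur := hin h
      have hnn := sol.nonneg_of_pos_endpoints hneg (by rw [hur]; linarith) (by linarith)
      have := sol.momentum_lt_of_large_weight hb hh hh0 hℓ (by linarith) (by simpa using hb1) hb2
        hm (by simpa using hlarge) hur (by linarith) hnn
      linarith
    · refine sol.ne_of_abs_momentum_sub_lt hT (fun t ht => ?_) (sub_eq_zero.1 h1)
      rw [hout h]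
      have := sol.abs_momentum_sub_le hb hB0 le_rfl ht.1 ht.2 fun x _ => hB _
      rw [← hKdef] at this
      linarith

theorem Function.Periodic.exists_extension {T : ℝ} (hT : 0 < T) {f : ℝ → ℝ} (hf : Continuous f)
    (h : f T = f 0) : ∃ F : ℝ → ℝ, Continuous F ∧ Function.Periodic F T ∧
      ∀ t ∈ Icc 0 T, F t = f t := by
  have : Fact (0 < T) := ⟨hT⟩
  have hF : ∀ t ∈ Ico 0 T, AddCircle.liftIco T 0 f (t : AddCircle T) = f t := fun t ht =>
    AddCircle.liftIco_coe_apply (by simpa using ht)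
  have hper : Function.Periodic (fun t : ℝ => AddCircle.liftIco T 0 f (t : AddCircle T)) T :=
    fun t => by simp only [AddCircle.coe_add_period]
  refine ⟨fun t => AddCircle.liftIco T 0 f (t : AddCircle T),
    (AddCircle.liftIco_continuous (by simpa using h.symm) hf.continuousOn).comp
      (AddCircle.continuous_mk' T), hper, fun t ht => ?_⟩
  rcases ht.2.lt_or_eq with h' | rfl
  · exact hF t ⟨ht.1, h'⟩
  · have h1 := hper 0
    rw [zero_add] at h1
    exact h1.trans ((hF 0 ⟨le_rfl, hT⟩).trans h.symm)

/-- A periodic function which is a primitive of a periodic function on one period is a primitive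
everywhere. -/
theorem Function.Periodic.sub_eq_integral {T : ℝ} (hT : 0 < T) {U f : ℝ → ℝ}
    (hU : Function.Periodic U T) (hf : Function.Periodic f T)
    (hfi : ∀ p q, IntervalIntegrable f volume p q)
    (h : ∀ t ∈ Icc 0 T, U t - U 0 = ∫ x in (0 : ℝ)..t, f x) (s t : ℝ) :
    U t - U s = ∫ x in s..t, f x := by
  have hT0 : ∫ x in (0 : ℝ)..T, f x = 0 := by
    rw [← h T ⟨hT.le, le_rfl⟩, sub_eq_zero]
    simpa using hU 0
  have hD : Function.Periodic (fun t => U t - ∫ x in (0 : ℝ)..t, f x) T := by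
    intro t
    have h1 : ∫ x in t..(t + T), f x = 0 := by
      rw [hf.intervalIntegral_add_eq t 0, zero_add, hT0]
    have h2 := intervalIntegral.integral_add_adjacent_intervals (hfi 0 t) (hfi t (t + T))
    simp only [hU t]
    linarith
  have hall : ∀ t, U t - U 0 = ∫ x in (0 : ℝ)..t, f x := by
    intro t
    obtain ⟨y, hy, hyt⟩ := hD.exists_mem_Ico₀ hT t
    have h1 := h y ⟨hy.1, hy.2.le⟩
    linarith
  have h2 := intervalIntegral.integral_add_adjacent_intervals (hfi 0 s) (hfi s t)
  linarith [hall s, hall t]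

theorem PlanarSol.exists_periodic_extension {b h u v : ℝ → ℝ} {T : ℝ} (hT : 0 < T)
    (hb : ∀ p q, IntervalIntegrable b volume p q) (hbT : Function.Periodic b T)
    (hh : Continuous h) (S : PlanarSol b h 0 T u v) (hu : u T = u 0) (hv : v T = v 0) :
    ∃ U V : ℝ → ℝ, Function.Periodic U T ∧ Function.Periodic V T ∧
      (∀ p q, PlanarSol b h p q U V) ∧ (∀ t ∈ Icc 0 T, U t = u t) ∧
      ∀ t ∈ Icc 0 T, V t = v t := by
  obtain ⟨U, cU, pU, eU⟩ := Function.Periodic.exists_extension hT S.cu hu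
  obtain ⟨V, cV, pV, eV⟩ := Function.Periodic.exists_extension hT S.cv hv
  have h0 : (0 : ℝ) ∈ Icc 0 T := ⟨le_rfl, hT.le⟩
  have hU := pU.sub_eq_integral hT (f := fun x => relVel (V x)) (fun t => by simp only [pV t])
    (fun p q => (continuous_relVel.comp cV).intervalIntegrable p q) fun t ht => by
      rw [eU t ht, eU 0 h0, S.eu 0 h0 t ht]
      refine intervalIntegral.integral_congr fun x hx => ?_
      rw [uIcc_of_le ht.1] at hx
      simp only [eV x ⟨hx.1, hx.2.trans ht.2⟩]
  have hi : ∀ p q, IntervalIntegrable (fun x => b x * h (U x)) volume p q :=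
    intervalIntegrable_mul_of_continuous hb (hh.comp cU)
  have hV := pV.sub_eq_integral hT (f := fun x => -(b x * h (U x)))
    (fun t => by simp only [pU t, hbT t]) (fun p q => (hi p q).neg) fun t ht => by
      rw [eV t ht, eV 0 h0, S.ev 0 h0 t ht, intervalIntegral.integral_neg]
      congr 1
      refine intervalIntegral.integral_congr fun x hx => ?_
      rw [uIcc_of_le ht.1] at hx
      simp only [eU x ⟨hx.1, hx.2.trans ht.2⟩]
  refine ⟨U, V, pU, pV, fun p q => ⟨cU, cV, fun s _ t _ => hU s t, fun s _ t _ => ?_⟩, eU, eV⟩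
  rw [hV s t, intervalIntegral.integral_neg]

theorem PlanarSol.hasDerivAt {b h U V : ℝ → ℝ} (S : ∀ p q, PlanarSol b h p q U V) (t : ℝ) :
    HasDerivAt U (relVel (V t)) t := by
  have hU : U = fun t => U 0 + ∫ x in (0 : ℝ)..t, relVel (V x) := by
    funext t
    have := (S (min 0 t) (max 0 t)).eu 0 ⟨min_le_left _ _, le_max_left _ _⟩ t
      ⟨min_le_right _ _, le_max_right _ _⟩
    linarith
  have hc : Continuous fun x => relVel (V x) := continuous_relVel.comp (S 0 0).cv
  rw [hU]
  exact (hc.integral_hasStrictDerivAt 0 t).hasDerivAt.const_add _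

/-- A nonnegative nontrivial periodic solution is positive. -/
theorem PlanarSol.pos_of_nonneg {b h U V : ℝ → ℝ} {T : ℝ} (hT : 0 < T)
    (hb : ∀ p q, IntervalIntegrable b volume p q)
    (hsmall : ∀ ε > 0, ∃ s₀ > 0, ∀ s ≤ s₀, |h s| ≤ ε * max s 0)
    (S : ∀ p q, PlanarSol b h p q U V) (hU : Function.Periodic U T) (hnn : ∀ t, 0 ≤ U t)
    (h0 : 0 < U 0 ∨ V 0 ≠ 0) (t : ℝ) : 0 < U t := by
  have rel0 : ∀ s, relVel s = 0 → s = 0 := fun s hs =>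
    strictMono_relVel.injective (hs.trans relVel_zero.symm)
  refine (hnn t).lt_of_ne fun ht => ?_
  have hmin : IsLocalMin U t := Eventually.of_forall fun s => by rw [← ht]; exact hnn s
  have hVt := rel0 _ (hmin.hasDerivAt_eq_zero (PlanarSol.hasDerivAt S t))
  have hz := (S t (t + T)).eq_zero_of_initial_zero hb (by linarith) hsmall ht.symm hVt
  have hall : U = fun _ => 0 := by
    funext s
    obtain ⟨y, hy, hys⟩ := hU.exists_mem_Ico hT s t
    rw [hys, hz y (Ico_subset_Icc_self hy)]
  have hd := PlanarSol.hasDerivAt S 0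
  rw [hall] at hd
  rcases h0 with h0 | h0
  · rw [hall] at h0
    exact lt_irrefl _ h0
  · exact h0 (rel0 _ (hd.unique (hasDerivAt_const _ _)))

/-- A continuous function on `[0, ∞)` extended by its value at `0` to the left and frozen to the
right of `M`. -/
def truncation (g : ℝ → ℝ) (M s : ℝ) : ℝ := g (max 0 (min s M))

section truncation

variable {g : ℝ → ℝ} {M : ℝ}

theorem truncation_eq {s : ℝ} (h0 : 0 ≤ s) (hM : s ≤ M) : truncation g M s = g s := by
  rw [truncation, min_eq_left hM, max_eq_right h0]

theorem truncation_of_nonpos (hg0 : g 0 = 0) {s : ℝ} (hs : s ≤ 0) : truncation g M s = 0 := by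
  rw [truncation, max_eq_left ((min_le_left _ _).trans hs), hg0]

theorem continuous_truncation (hg : ContinuousOn g (Ici 0)) : Continuous (truncation g M) :=
  hg.comp_continuous (by fun_prop) fun s => mem_Ici.2 (le_max_left _ _)

theorem truncation_pos (hg : ∀ s, 0 < s → 0 < g s) (hM : 0 < M) {s : ℝ} (hs : 0 < s) :
    0 < truncation g M s :=
  hg _ (lt_max_of_lt_right (lt_min hs hM))

theorem truncation_nonneg (hg0 : g 0 = 0) (hg : ∀ s, 0 < s → 0 < g s) (hM : 0 < M) (s : ℝ) :
    0 ≤ truncation g M s := by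
  rcases le_or_gt s 0 with hs | hs
  · rw [truncation_of_nonpos hg0 hs]
  · exact (truncation_pos hg hM hs).le

theorem exists_abs_truncation_le (hg : ContinuousOn g (Ici 0)) (hM : 0 ≤ M) :
    ∃ B, ∀ s, |truncation g M s| ≤ B := by
  obtain ⟨B, hB⟩ := isCompact_Icc.exists_bound_of_continuousOn
    (hg.mono (Icc_subset_Ici_self : Icc 0 M ⊆ Ici 0))
  exact ⟨B, fun s => hB _ ⟨le_max_left _ _, max_le hM (min_le_right _ _)⟩⟩

theorem abs_truncation_le_of_tendsto (hg0 : g 0 = 0) (hg : ∀ s, 0 < s → 0 < g s) (hM : 0 < M)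
    (hgz : Tendsto (fun s => g s / s) (nhdsWithin 0 (Ioi 0)) (nhds 0)) {ε : ℝ} (hε : 0 < ε) :
    ∃ s₀ > 0, ∀ s ≤ s₀, |truncation g M s| ≤ ε * max s 0 := by
  have h1 := hgz.eventually (Iio_mem_nhds hε)
  obtain ⟨s₁, hs₁, H⟩ := mem_nhdsGT_iff_exists_Ioc_subset.1 h1
  refine ⟨min s₁ M, lt_min hs₁ hM, fun s hs => ?_⟩
  rcases le_or_gt s 0 with h | h
  · rw [truncation_of_nonpos hg0 h, max_eq_right h]; simp
  · have h2 : g s / s < ε := H ⟨h, hs.trans (min_le_left _ _)⟩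
    rw [truncation_eq h.le (hs.trans (min_le_right _ _)), abs_of_pos (hg s h), max_eq_left h.le]
    exact ((div_lt_iff₀ h).1 h2).le

theorem abs_truncation_sub_le_of_regOscZero (hg : ∀ s, 0 < s → 0 < g s) (hM : 0 < M)
    (hreg : RegOscZero g) {κ : ℝ} (hκ : 0 < κ) :
    ∃ δ > 0, ∃ r₀ > 0, ∀ r, 0 < r → r < r₀ → ∀ s, |s - r| ≤ δ * r →
      |truncation g M s - truncation g M r| ≤ κ * truncation g M r := by
  have h1 := hreg.eventually (Metric.ball_mem_nhds 1 hκ)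
  obtain ⟨A, hA, C, hC, H⟩ := eventually_prod_iff.1 h1
  obtain ⟨δ, hδ, hA⟩ := Metric.mem_nhds_iff.1 hA
  obtain ⟨r₁, hr₁, hC⟩ := mem_nhdsGT_iff_exists_Ioc_subset.1 hC
  refine ⟨min (δ / 2) (1 / 2), by positivity, min r₁ (M / 2),
    lt_min hr₁ (by positivity), fun r hr hr' s hs => ?_⟩
  have hr1 : r < r₁ := hr'.trans_le (min_le_left _ _)
  have hr2 : r < M / 2 := hr'.trans_le (min_le_right _ _)
  have hs1 : |s - r| ≤ δ / 2 * r := hs.trans (mul_le_mul_of_nonneg_right (min_le_left _ _) hr.le)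
  have hs2 : |s - r| ≤ 1 / 2 * r := hs.trans (mul_le_mul_of_nonneg_right (min_le_right _ _) hr.le)
  have hs3 := abs_le.1 hs2
  rw [truncation_eq (by linarith) (by linarith), truncation_eq hr.le (by linarith)]
  have hω : s / r ∈ Metric.ball (1 : ℝ) δ := by
    rw [Metric.mem_ball, Real.dist_eq, div_sub_one hr.ne', abs_div, abs_of_pos hr,
      div_lt_iff₀ hr]
    nlinarith
  have h2 : g (s / r * r) / g r ∈ Metric.ball 1 κ := H (hA hω) (hC ⟨hr, hr1.le⟩)
  have hgr := hg r hr
  rw [div_mul_cancel₀ _ hr.ne', Metric.mem_ball, Real.dist_eq, div_sub_one hgr.ne', abs_div,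
    abs_of_pos hgr, div_lt_iff₀ hgr] at h2
  exact h2.le

end truncation

theorem intervalIntegral_pos_of_ae_pos {f : ℝ → ℝ} {p q : ℝ} (hpq : p < q)
    (hf : IntervalIntegrable f volume p q) (hpos : ∀ᵐ x, x ∈ Icc p q → 0 < f x) :
    0 < ∫ x in p..q, f x := by
  have h1 : ∀ᵐ x, x ∈ Ioc p q → 0 < f x :=
    hpos.mono fun x hx hxm => hx (Ioc_subset_Icc_self hxm)
  rw [intervalIntegral.integral_pos_iff_support_of_nonneg_ae' _ hf]
  · refine ⟨hpq, ?_⟩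
    have h2 : (Ioc p q : Set ℝ) ≤ᵐ[volume] (Function.support f ∩ Ioc p q : Set ℝ) := by
      filter_upwards [h1] with x hx hxm
      exact ⟨(hx hxm).ne', hxm⟩
    refine lt_of_lt_of_le ?_ (measure_mono_ae h2)
    simpa using hpq
  · rw [uIoc_of_le hpq.le, EventuallyLE, ae_restrict_iff' measurableSet_Ioc]
    exact h1.mono fun x hx hxm => (hx hxm).le

theorem ae_comp_add_right {P : ℝ → Prop} (h : ∀ᵐ x, P x) (c : ℝ) : ∀ᵐ x, P (x + c) :=
  (measurePreserving_add_right volume c).quasiMeasurePreserving.ae h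

theorem isPeriodicSol_of_shift {a g h U V : ℝ → ℝ} {T lam c : ℝ}
    (hb : ∀ p q, IntervalIntegrable (fun t => lam * a (t + c)) volume p q) (hh : Continuous h)
    (S : ∀ p q, PlanarSol (fun t => lam * a (t + c)) h p q U V)
    (hU : Function.Periodic U T) (hV : Function.Periodic V T) (hg : ∀ t, h (U t) = g (U t)) :
    IsPeriodicSol T (fun _ s => s / Real.sqrt (1 + s ^ 2)) (fun t x => -(lam * a t * g x))
      (fun t => U (t - c)) (fun t => V (t - c)) := by
  have cU := (S 0 0).cu
  have cV := (S 0 0).cv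
  have hi : ∀ p q, IntervalIntegrable (fun t => lam * a (t + c) * h (U t)) volume p q :=
    intervalIntegrable_mul_of_continuous hb (hh.comp cU)
  have hrel : Continuous fun t => relVel (V (t - c)) := continuous_relVel.comp (by fun_prop)
  have e : (fun t => -(lam * a t * g (U (t - c)))) =
      fun t => (fun t => -(lam * a (t + c) * h (U t))) (t - c) := by
    funext t
    simp only [sub_add_cancel, hg]
  refine ⟨by fun_prop, by fun_prop, fun t => ?_, fun t => ?_,
    fun p q => hrel.intervalIntegrable p q, fun p q => ?_, fun t => ?_, fun t => ?_⟩
  · simp only [add_sub_right_comm t T c, hU (t - c)]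
  · simp only [add_sub_right_comm t T c, hV (t - c)]
  · rw [e]
    simpa using ((hi (p - c) (q - c)).neg).comp_sub_right c
  · have h1 := (S (min (0 - c) (t - c)) (max (0 - c) (t - c))).eu (0 - c)
      ⟨min_le_left _ _, le_max_left _ _⟩ (t - c) ⟨min_le_right _ _, le_max_right _ _⟩
    rw [← intervalIntegral.integral_comp_sub_right (fun x => relVel (V x)) c] at h1
    simp only [relVel] at h1
    linarith
  · have h1 := (S (min (0 - c) (t - c)) (max (0 - c) (t - c))).ev (0 - c)
      ⟨min_le_left _ _, le_max_left _ _⟩ (t - c) ⟨min_le_right _ _, le_max_right _ _⟩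
    rw [← intervalIntegral.integral_neg,
      ← intervalIntegral.integral_comp_sub_right (fun x => -(lam * a (x + c) * h (U x))) c] at h1
    rw [e]
    linarith

theorem statement18
    (T : ℝ) (hT : 0 < T)
    (a : ℝ → ℝ) (haloc : LocallyIntegrable a volume)
    (haper : Function.Periodic a T)
    (haneg : (∫ t in (0:ℝ)..T, a t) < 0)
    (N : ℕ) (σ τ : Fin (N + 1) → ℝ) (hstar : SignChanging T a N σ τ)
    (g : ℝ → ℝ) (hgc : ContinuousOn g (Set.Ici 0))
    (hg0 : g 0 = 0) (hgpos : ∀ s : ℝ, 0 < s → 0 < g s)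
    (hreg : RegOscZero g)
    (hgzero : Tendsto (fun s => g s / s) (nhdsWithin 0 (Set.Ioi 0)) (nhds 0)) :
    ∃ lam0 : ℝ, 0 < lam0 ∧ ∀ lam : ℝ, lam0 < lam →
      ∃ u v : ℝ → ℝ,
        IsPeriodicSol T (fun _ s => s / Real.sqrt (1 + s ^ 2))
          (fun t x => -(lam * a t * g x)) u v ∧ ∀ t, 0 < u t := by
  have hστ := hstar.1 0
  have hτT := hstar.2.2.1 0
  have hpos := hstar.2.2.2.1 0
  set c := (σ 0 + τ 0) / 2 with hc
  set ℓ := (τ 0 - σ 0) / 2 with hℓdef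
  have hℓ : 0 < ℓ := by linarith
  have hM : 0 < ℓ / 8 + T := by positivity
  set h := truncation g (ℓ / 8 + T) with hdef
  have hh : Continuous h := continuous_truncation hgc
  obtain ⟨B, hB⟩ := exists_abs_truncation_le hgc hM.le
  have hsmall : ∀ ε > 0, ∃ s₀ > 0, ∀ s ≤ s₀, |h s| ≤ ε * max s 0 := fun ε hε =>
    abs_truncation_le_of_tendsto hg0 hgpos hM hgzero hε
  have hneg : ∀ s ≤ 0, h s = 0 := fun s hs => truncation_of_nonpos hg0 hs
  have ha : ∀ p q, IntervalIntegrable a volume p q := fun p q =>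
    (haloc.integrableOn_isCompact isCompact_uIcc).intervalIntegrable
  have hac : ∀ p q, IntervalIntegrable (fun t => a (t + c)) volume p q := fun p q => by
    simpa using (ha (p + c) (q + c)).comp_add_right c
  have hpos1 : ∀ᵐ x, x ∈ Icc 0 ℓ → 0 < a (x + c) := by
    filter_upwards [ae_comp_add_right hpos c] with x hx hxm
    exact hx ⟨by linarith [hxm.1], by linarith [hxm.2]⟩
  have hpos2 : ∀ᵐ x, x ∈ Icc (T - ℓ) T → 0 < a (x + c) := by
    filter_upwards [ae_comp_add_right hpos (c - T)] with x hx hxm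
    have := hx ⟨by linarith [hxm.1], by linarith [hxm.2]⟩
    rwa [← add_sub_assoc, haper.sub_eq] at this
  have hA : 0 < ∫ x in (0 : ℝ)..(ℓ / 8), a (x + c) :=
    intervalIntegral_pos_of_ae_pos (by linarith) (hac _ _)
      (hpos1.mono fun x hx hxm => hx ⟨hxm.1, by linarith [hxm.2]⟩)
  set A := ∫ x in (0 : ℝ)..(ℓ / 8), a (x + c) with hAdef
  obtain ⟨s₁, hs₁, hmin⟩ := (isCompact_Icc (a := ℓ / 16) (b := ℓ / 4)).exists_isMinOn
    (nonempty_Icc.2 (by linarith)) hh.continuousOn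
  have hm : 0 < h s₁ := truncation_pos hgpos hM (by linarith [hs₁.1])
  refine ⟨2 / (h s₁ * A), by positivity, fun lam hlam => ?_⟩
  have hlam0 : 0 < lam := lt_trans (by positivity) hlam
  have hb : ∀ p q, IntervalIntegrable (fun t => lam * a (t + c)) volume p q := fun p q =>
    (hac p q).const_mul lam
  obtain ⟨u, v, sol, hu, hv, h0, hle⟩ := exists_periodic_planarSol (m := h s₁) hT hb hh hB
    (truncation_nonneg hg0 hgpos hM) hneg (fun s hs => truncation_pos hgpos hM hs) hsmall
    (fun κ hκ => abs_truncation_sub_le_of_regOscZero hgpos hM hreg hκ)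
    (by
      have e := haper.intervalIntegral_add_eq c 0
      rw [zero_add] at e
      rw [intervalIntegral.integral_const_mul, intervalIntegral.integral_comp_add_right a c,
        zero_add, add_comm T c, e]
      exact mul_neg_of_pos_of_neg hlam0 haneg)
    hℓ (by linarith)
    (hpos1.mono fun x hx hxm => (mul_pos hlam0 (hx hxm)).le)
    (hpos2.mono fun x hx hxm => (mul_pos hlam0 (hx hxm)).le)
    (fun s hs => hmin hs)
    (by
      rw [intervalIntegral.integral_const_mul, ← hAdef]
      have := (div_lt_iff₀ (by positivity)).1 hlam
      linarith)
  obtain ⟨U, V, pU, pV, S, eU, eV⟩ := sol.exists_periodic_extension hT hb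
    (fun t => by simp only [add_right_comm t T c, haper (t + c)]) hh hu hv
  have z : (0 : ℝ) ∈ Icc 0 T := ⟨le_rfl, hT.le⟩
  have hnn : ∀ t, 0 ≤ U t := fun t => by
    obtain ⟨y, hy, e⟩ := pU.exists_mem_Ico₀ hT t
    rw [e, eU y (Ico_subset_Icc_self hy)]
    exact sol.nonneg_of_periodic hneg hT hu hv h0 y (Ico_subset_Icc_self hy)
  have hUM : ∀ t, U t ≤ ℓ / 8 + T := fun t => by
    obtain ⟨y, hy, e⟩ := pU.exists_mem_Ico₀ hT t
    rw [e, eU y (Ico_subset_Icc_self hy)]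
    have := sol.sub_le_of_relVel_le le_rfl hy.1 hy.2.le (κ := 1) fun x _ =>
      (le_abs_self _).trans (abs_relVel_le_one _)
    linarith [hy.2]
  exact ⟨_, _, isPeriodicSol_of_shift hb hh S pU pV fun t => truncation_eq (hnn t) (hUM t),
    fun t => PlanarSol.pos_of_nonneg hT hb hsmall S pU hnn
      (by rwa [← eU 0 z, ← eV 0 z] at h0) _⟩
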